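/- arXiv:2109.01248 — 2 statements merged into one kernel-verified Lean document; each statement's English description precedes it below -/
import Mathlib

section
/- Let Λ be a finite dimensional algebra over a field K. Then the following are equivalent: (1) Λ is CM-τ-tilting finite; (2) there are only finitely many isomorphism classes of indecomposable Gorenstein projective τ-rigid modules in mod Λ; (3) Λ^op is CM-τ-tilting finite; (4) there are only finitely many isomorphism classes of indecomposable Gorenstein projective τ-rigid modules in mod Λ^op. In particular, Λ is CM-τ-tilting finite if and only if Λ^op is CM-τ-tilting finite. -/
/-!  Common definitions: Gorenstein projective/injective modules, transpose,
Auslander–Reiten translation, τ-rigid and τ-tilting modules and pairs,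
torsion pairs, etc., over a finite dimensional algebra.
Throughout, "mod Λ" is modelled by the category of finitely generated
(left) modules over a finite dimensional `K`-algebra `R`, and
"mod Λᵒᵖ" by finitely generated `Rᵐᵒᵖ`-modules. -/

universe u

open Function MulOpposite

namespace GPTau

section Ring

variable (R : Type u) [Ring R]

/-- A submodule `N ≤ M` is superfluous (small) if `N ⊔ N' = ⊤` implies `N' = ⊤`. -/
def IsSuperfluous {M : Type u} [AddCommGroup M] [Module R M] (N : Submodule R M) : Prop :=
  ∀ N' : Submodule R M, N ⊔ N' = ⊤ → N' = ⊤

/-- `M` is Gorenstein projective: there is a doubly infinite exact sequence of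
finitely generated projective modules which stays exact under `Hom(-, R)` and
such that `M ≅ Im (P₋₁ → P₀)`. -/
def IsGP (M : Type u) [AddCommGroup M] [Module R M] : Prop :=
  ∃ (P : ℤ → Type u) (_ : ∀ n, AddCommGroup (P n)) (_ : ∀ n, Module R (P n))
    (d : ∀ n : ℤ, P n →ₗ[R] P (n + 1)),
    (∀ n, Module.Finite R (P n)) ∧
    (∀ n, Module.Projective R (P n)) ∧
    (∀ n, Function.Exact (d n) (d (n + 1))) ∧
    (∀ n, Function.Exact
      (fun g : P (n + 1 + 1) →ₗ[R] R => g.comp (d (n + 1)))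
      (fun g : P (n + 1) →ₗ[R] R => g.comp (d n))) ∧
    Nonempty (M ≃ₗ[R] LinearMap.range (d (-1)))

/-- A linear map factors through a (finitely generated) projective module. -/
def FactorsThroughProj {A B : Type u} [AddCommGroup A] [Module R A]
    [AddCommGroup B] [Module R B] (f : A →ₗ[R] B) : Prop :=
  ∃ (Q : Type u) (_ : AddCommGroup Q) (_ : Module R Q),
    Module.Projective R Q ∧ ∃ (a : A →ₗ[R] Q) (b : Q →ₗ[R] B), b.comp a = f

/-- Two maps are equal in the stable category (mod projectives). -/
def StEq {A B : Type u} [AddCommGroup A] [Module R A] [AddCommGroup B] [Module R B]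
    (f g : A →ₗ[R] B) : Prop :=
  FactorsThroughProj R (f - g)

/-- An indecomposable module. -/
def IsIndec (M : Type u) [AddCommGroup M] [Module R M] : Prop :=
  Nontrivial M ∧ ∀ N₁ N₂ : Submodule R M, IsCompl N₁ N₂ → N₁ = ⊥ ∨ N₂ = ⊥

/-- `|M| = k` : `M` decomposes into indecomposable direct summands having
exactly `k` isomorphism classes. -/
def NumIndec (M : Type u) [AddCommGroup M] [Module R M] (k : ℕ) : Prop :=
  ∃ (n : ℕ) (N : Fin n → Submodule R M),
    DirectSum.IsInternal N ∧ (∀ i, IsIndec R (N i)) ∧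
    ∃ c : Fin n → Fin k, Surjective c ∧
      ∀ i j, (c i = c j ↔ Nonempty ((N i) ≃ₗ[R] (N j)))

/-- A basic module: it is a direct sum of pairwise nonisomorphic indecomposables. -/
def IsBasic (M : Type u) [AddCommGroup M] [Module R M] : Prop :=
  ∃ (n : ℕ) (N : Fin n → Submodule R M),
    DirectSum.IsInternal N ∧ (∀ i, IsIndec R (N i)) ∧
    ∀ i j, i ≠ j → ¬ Nonempty ((N i) ≃ₗ[R] (N j))

/-- `M` has no nonzero projective direct summand. -/
def NoProjSummand (M : Type u) [AddCommGroup M] [Module R M] : Prop :=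
  ∀ N₁ N₂ : Submodule R M, IsCompl N₁ N₂ → Module.Projective R N₁ → N₁ = ⊥

/-- `X` is a direct summand of `T`. -/
def IsDirectSummand (X T : Type u) [AddCommGroup X] [Module R X]
    [AddCommGroup T] [Module R T] : Prop :=
  ∃ (i : X →ₗ[R] T) (p : T →ₗ[R] X), p.comp i = LinearMap.id

/-- `Ext¹(X, Y) = 0`: every short exact sequence `0 → Y → E → X → 0` splits. -/
def Ext1Vanishes (X Y : Type u) [AddCommGroup X] [Module R X]
    [AddCommGroup Y] [Module R Y] : Prop :=
  ∀ (E : Type u) [AddCommGroup E] [Module R E] (i : Y →ₗ[R] E) (p : E →ₗ[R] X),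
    Injective i → Surjective p → Function.Exact i p →
    ∃ s : X →ₗ[R] E, p.comp s = LinearMap.id

/-- `X ∈ Fac G`: `X` is a quotient of a finite direct sum of copies of `G`. -/
def FacOf (G X : Type u) [AddCommGroup G] [Module R G] [AddCommGroup X] [Module R X] : Prop :=
  ∃ (n : ℕ) (p : (Fin n → G) →ₗ[R] X), Surjective p

/-- `X ∈ Sub C`: `X` embeds into a finite direct sum of copies of `C`. -/
def SubOf (C X : Type u) [AddCommGroup C] [Module R C] [AddCommGroup X] [Module R X] : Prop :=
  ∃ (n : ℕ) (i : X →ₗ[R] (Fin n → C)), Injective i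

/-- `X ∈ add G`: `X` is a direct summand of a finite direct sum of copies of `G`. -/
def InAdd (G X : Type u) [AddCommGroup G] [Module R G] [AddCommGroup X] [Module R X] : Prop :=
  ∃ (n : ℕ) (i : X →ₗ[R] (Fin n → G)) (p : (Fin n → G) →ₗ[R] X), p.comp i = LinearMap.id

/-- The Jacobson radical of `R` (as a left ideal). -/
def JacobsonRad : Ideal R := (⊥ : Ideal R).jacobson

/-- The Jacobson radical squares to zero. -/
def RadSquareZero : Prop :=
  ∀ x y : R, x ∈ JacobsonRad R → y ∈ JacobsonRad R → x * y = 0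

/-- A uniserial module: its submodules form a chain. -/
def IsUniserial (M : Type u) [AddCommGroup M] [Module R M] : Prop :=
  ∀ N₁ N₂ : Submodule R M, N₁ ≤ N₂ ∨ N₂ ≤ N₁

/-- `R` has finite global dimension: there is `n` such that every finitely
generated module has a projective resolution vanishing in degrees `> n`. -/
def FiniteGlobalDimension : Prop :=
  ∃ n : ℕ, ∀ (M : Type u) [AddCommGroup M] [Module R M], Module.Finite R M →
    ∃ (P : ℕ → Type u) (_ : ∀ i, AddCommGroup (P i)) (_ : ∀ i, Module R (P i))
      (d : ∀ i : ℕ, P (i + 1) →ₗ[R] P i) (ε : P 0 →ₗ[R] M),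
      (∀ i, Module.Projective R (P i)) ∧ Surjective ε ∧
      Function.Exact (d 0) ε ∧ (∀ i, Function.Exact (d (i + 1)) (d i)) ∧
      (∀ i, n < i → Subsingleton (P i))

/-- The injective dimension of `R` as a module over itself is at most 1. -/
def SelfInjDimLE1 : Prop :=
  ∃ (I₀ I₁ : Type u) (_ : AddCommGroup I₀) (_ : Module R I₀)
    (_ : AddCommGroup I₁) (_ : Module R I₁),
    Module.Finite R I₀ ∧ Module.Finite R I₁ ∧
    Module.Injective R I₀ ∧ Module.Injective R I₁ ∧
    ∃ (i : R →ₗ[R] I₀) (p : I₀ →ₗ[R] I₁),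
      Injective i ∧ Surjective p ∧ Function.Exact i p

end Ring

section Algebra

variable (R : Type u) [Ring R] (K : Type u) [Field K] [Algebra K R]

/-- For an algebra over a field, the scalars of the base field commute with the
ring action on any compatible module. -/
instance (priority := 100) smulCommClass_of_tower (M : Type u) [AddCommGroup M]
    [Module R M] [Module K M] [IsScalarTower K R M] : SMulCommClass R K M :=
  ⟨fun r k m => by
    rw [← algebraMap_smul R k m, ← mul_smul, ← Algebra.commutes, mul_smul, algebraMap_smul]⟩

end Algebra

section OpDual

variable (R : Type u) [Ring R] (K : Type u) [Field K] [Algebra K R]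
variable (M : Type u) [AddCommGroup M] [Module Rᵐᵒᵖ M] [Module K M]
  [IsScalarTower K Rᵐᵒᵖ M]

/-- The `K`-dual of a (finitely generated) `Rᵐᵒᵖ`-module, as an `R`-module:
this is the duality `D : mod Λᵒᵖ → mod Λ`. -/
def OpDual (R : Type u) [Ring R] (K : Type u) [Field K] [Algebra K R]
    (M : Type u) [AddCommGroup M] [Module Rᵐᵒᵖ M] [Module K M]
    [IsScalarTower K Rᵐᵒᵖ M] : Type u := M →ₗ[K] K

instance : AddCommGroup (OpDual R K M) := inferInstanceAs (AddCommGroup (M →ₗ[K] K))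

instance : Module K (OpDual R K M) := inferInstanceAs (Module K (M →ₗ[K] K))

/-- Scalar action `x ↦ op r • x` as a `K`-linear map. -/
def opSmulHom (r : R) : M →ₗ[K] M where
  toFun x := op r • x
  map_add' x y := smul_add _ x y
  map_smul' k x := smul_comm (op r) k x

/-- Reinterpret an element of the dual as a linear functional. -/
def OpDual.toL (f : OpDual R K M) : M →ₗ[K] K := f

lemma OpDual.toL_injective :
    Function.Injective (OpDual.toL R K M) := fun _ _ h => h

instance : SMul R (OpDual R K M) :=
  ⟨fun r f => ((OpDual.toL R K M f).comp (opSmulHom R K M r) : M →ₗ[K] K)⟩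

lemma OpDual.smul_toL (r : R) (f : OpDual R K M) (x : M) :
    OpDual.toL R K M (r • f) x = OpDual.toL R K M f (op r • x) := rfl

lemma OpDual.toL_add (f g : OpDual R K M) :
    OpDual.toL R K M (f + g) = OpDual.toL R K M f + OpDual.toL R K M g := rfl

lemma OpDual.toL_zero : OpDual.toL R K M 0 = 0 := rfl

instance : Module R (OpDual R K M) where
  one_smul f := OpDual.toL_injective R K M <| LinearMap.ext fun x => by
    rw [OpDual.smul_toL, op_one, one_smul]
  mul_smul r s f := OpDual.toL_injective R K M <| LinearMap.ext fun x => by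
    rw [OpDual.smul_toL, OpDual.smul_toL, OpDual.smul_toL, op_mul, mul_smul]
  smul_zero r := OpDual.toL_injective R K M <| LinearMap.ext fun x => by
    rw [OpDual.smul_toL, OpDual.toL_zero]; simp
  smul_add r f g := OpDual.toL_injective R K M <| LinearMap.ext fun x => by
    rw [OpDual.smul_toL, OpDual.toL_add]
    simp only [LinearMap.add_apply, OpDual.toL_add]
    rw [OpDual.smul_toL, OpDual.smul_toL]
  add_smul r s f := OpDual.toL_injective R K M <| LinearMap.ext fun x => by
    rw [OpDual.smul_toL]
    simp only [OpDual.toL_add, LinearMap.add_apply]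
    rw [OpDual.smul_toL, OpDual.smul_toL, op_add, add_smul, map_add]
  zero_smul f := OpDual.toL_injective R K M <| LinearMap.ext fun x => by
    rw [OpDual.smul_toL, OpDual.toL_zero, op_zero, zero_smul, map_zero]; rfl

instance : IsScalarTower K R (OpDual R K M) :=
  ⟨fun k r f => OpDual.toL_injective R K M <| LinearMap.ext fun x => by
    have h1 : OpDual.toL R K M ((k • r) • f) x = OpDual.toL R K M f (op (k • r) • x) := rfl
    have h2 : OpDual.toL R K M (k • (r • f)) x = k • OpDual.toL R K M f (op r • x) := rfl
    rw [h1, h2, op_smul, smul_assoc, map_smul]⟩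

end OpDual

section LDual

variable (R : Type u) [Ring R] (K : Type u) [Field K] [Algebra K R]
variable (M : Type u) [AddCommGroup M] [Module R M] [Module K M]
  [IsScalarTower K R M]

/-- The `K`-dual of a (finitely generated) `R`-module, as an `Rᵐᵒᵖ`-module:
this is the duality `D : mod Λ → mod Λᵒᵖ`. -/
def LDual (R : Type u) [Ring R] (K : Type u) [Field K] [Algebra K R]
    (M : Type u) [AddCommGroup M] [Module R M] [Module K M]
    [IsScalarTower K R M] : Type u := M →ₗ[K] K

instance : AddCommGroup (LDual R K M) := inferInstanceAs (AddCommGroup (M →ₗ[K] K))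

instance : Module K (LDual R K M) := inferInstanceAs (Module K (M →ₗ[K] K))

/-- Scalar action `x ↦ r • x` as a `K`-linear map. -/
def lSmulHom (r : R) : M →ₗ[K] M where
  toFun x := r • x
  map_add' x y := smul_add _ x y
  map_smul' k x := smul_comm r k x

/-- Reinterpret an element of the dual as a linear functional. -/
def LDual.toL (f : LDual R K M) : M →ₗ[K] K := f

lemma LDual.toL_injective : Function.Injective (LDual.toL R K M) := fun _ _ h => h

instance : SMul Rᵐᵒᵖ (LDual R K M) :=
  ⟨fun s f => ((LDual.toL R K M f).comp (lSmulHom R K M (unop s)) : M →ₗ[K] K)⟩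

lemma LDual.smul_toL (s : Rᵐᵒᵖ) (f : LDual R K M) (x : M) :
    LDual.toL R K M (s • f) x = LDual.toL R K M f (unop s • x) := rfl

lemma LDual.toL_add (f g : LDual R K M) :
    LDual.toL R K M (f + g) = LDual.toL R K M f + LDual.toL R K M g := rfl

lemma LDual.toL_zero : LDual.toL R K M 0 = 0 := rfl

instance : Module Rᵐᵒᵖ (LDual R K M) where
  one_smul f := LDual.toL_injective R K M <| LinearMap.ext fun x => by
    rw [LDual.smul_toL, unop_one, one_smul]
  mul_smul s t f := LDual.toL_injective R K M <| LinearMap.ext fun x => by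
    rw [LDual.smul_toL, LDual.smul_toL, LDual.smul_toL, unop_mul, mul_smul]
  smul_zero s := LDual.toL_injective R K M <| LinearMap.ext fun x => by
    rw [LDual.smul_toL, LDual.toL_zero]; simp
  smul_add s f g := LDual.toL_injective R K M <| LinearMap.ext fun x => by
    rw [LDual.smul_toL, LDual.toL_add]
    simp only [LinearMap.add_apply, LDual.toL_add]
    rw [LDual.smul_toL, LDual.smul_toL]
  add_smul s t f := LDual.toL_injective R K M <| LinearMap.ext fun x => by
    rw [LDual.smul_toL]
    simp only [LDual.toL_add, LinearMap.add_apply]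
    rw [LDual.smul_toL, LDual.smul_toL, unop_add, add_smul, map_add]
  zero_smul f := LDual.toL_injective R K M <| LinearMap.ext fun x => by
    rw [LDual.smul_toL, LDual.toL_zero, unop_zero, zero_smul, map_zero]; rfl

instance : IsScalarTower K Rᵐᵒᵖ (LDual R K M) :=
  ⟨fun k s f => LDual.toL_injective R K M <| LinearMap.ext fun x => by
    have h1 : LDual.toL R K M ((k • s) • f) x = LDual.toL R K M f (unop (k • s) • x) := rfl
    have h2 : LDual.toL R K M (k • (s • f)) x = k • LDual.toL R K M f (unop s • x) := rfl
    rw [h1, h2, unop_smul, smul_assoc, map_smul]⟩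

end LDual

section GI

variable (R : Type u) [Ring R] (K : Type u) [Field K] [Algebra K R]

/-- `M` is Gorenstein injective: there is a doubly infinite exact sequence of
finitely generated injective modules which stays exact under `Hom(DΛ, -)` and
such that `M ≅ Im (I₋₁ → I₀)`. Here `DΛ = OpDual R K R` is the `K`-dual of the
regular module. -/
def IsGI (M : Type u) [AddCommGroup M] [Module R M] : Prop :=
  ∃ (I : ℤ → Type u) (_ : ∀ n, AddCommGroup (I n)) (_ : ∀ n, Module R (I n))
    (d : ∀ n : ℤ, I n →ₗ[R] I (n + 1)),
    (∀ n, Module.Finite R (I n)) ∧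
    (∀ n, Module.Injective R (I n)) ∧
    (∀ n, Function.Exact (d n) (d (n + 1))) ∧
    (∀ n, Function.Exact
      (fun g : OpDual R K R →ₗ[R] I n => (d n).comp g)
      (fun g : OpDual R K R →ₗ[R] I (n + 1) => (d (n + 1)).comp g)) ∧
    Nonempty (M ≃ₗ[R] LinearMap.range (d (-1)))

end GI



section MinPres

variable (R : Type u) [Ring R]

/-- A minimal projective presentation `P₁ → P₀ → M → 0`. -/
structure MinPres (M : Type u) [AddCommGroup M] [Module R M] : Type (u + 1) where
  P₁ : Type u
  P₀ : Type u
  [acg₁ : AddCommGroup P₁]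
  [acg₀ : AddCommGroup P₀]
  [mod₁ : Module R P₁]
  [mod₀ : Module R P₀]
  fin₁ : Module.Finite R P₁
  fin₀ : Module.Finite R P₀
  proj₁ : Module.Projective R P₁
  proj₀ : Module.Projective R P₀
  d : P₁ →ₗ[R] P₀
  p : P₀ →ₗ[R] M
  surj : Function.Surjective p
  exact : Function.Exact d p
  min₀ : IsSuperfluous R (LinearMap.ker p)
  min₁ : IsSuperfluous R (LinearMap.ker d)

attribute [instance] MinPres.acg₁ MinPres.acg₀ MinPres.mod₁ MinPres.mod₀

variable {R}
variable {M : Type u} [AddCommGroup M] [Module R M] (pr : MinPres R M)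

/-- The map `Hom(P₀, R) → Hom(P₁, R)` dual to `d`, as a map of `Rᵐᵒᵖ`-modules. -/
def MinPres.dualMap : (pr.P₀ →ₗ[R] R) →ₗ[Rᵐᵒᵖ] (pr.P₁ →ₗ[R] R) where
  toFun g := g.comp pr.d
  map_add' g h := by ext x; simp
  map_smul' s g := by ext x; simp

/-- The transpose `Tr M = Coker (Hom(P₀, R) → Hom(P₁, R))`, an `Rᵐᵒᵖ`-module. -/
def MinPres.Tr : Type u := (pr.P₁ →ₗ[R] R) ⧸ LinearMap.range pr.dualMap

instance : AddCommGroup pr.Tr :=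
  inferInstanceAs (AddCommGroup ((pr.P₁ →ₗ[R] R) ⧸ LinearMap.range pr.dualMap))

instance : Module Rᵐᵒᵖ pr.Tr :=
  inferInstanceAs (Module Rᵐᵒᵖ ((pr.P₁ →ₗ[R] R) ⧸ LinearMap.range pr.dualMap))

/-- The canonical projection onto the transpose. -/
def MinPres.toTr (h : pr.P₁ →ₗ[R] R) : pr.Tr :=
  Submodule.Quotient.mk (p := LinearMap.range pr.dualMap) h

section TauDef

variable (K : Type u) [Field K] [Algebra K R]

instance : Module K pr.Tr :=
  inferInstanceAs (Module K ((pr.P₁ →ₗ[R] R) ⧸ LinearMap.range pr.dualMap))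

instance : IsScalarTower K Rᵐᵒᵖ pr.Tr :=
  inferInstanceAs
    (IsScalarTower K Rᵐᵒᵖ ((pr.P₁ →ₗ[R] R) ⧸ LinearMap.range pr.dualMap))

/-- The Auslander–Reiten translate `τM = D (Tr M)`, an `R`-module. -/
def MinPres.tau : Type u := OpDual R K pr.Tr

instance : AddCommGroup (pr.tau K) := inferInstanceAs (AddCommGroup (OpDual R K pr.Tr))

instance : Module R (pr.tau K) := inferInstanceAs (Module R (OpDual R K pr.Tr))

instance : Module K (pr.tau K) := inferInstanceAs (Module K (OpDual R K pr.Tr))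

instance : IsScalarTower K R (pr.tau K) :=
  inferInstanceAs (IsScalarTower K R (OpDual R K pr.Tr))

end TauDef

end MinPres

section Tau

variable (R : Type u) [Ring R] (K : Type u) [Field K] [Algebra K R]

/-- `M` is τ-rigid: `Hom(M, τM) = 0`. -/
def IsTauRigid (M : Type u) [AddCommGroup M] [Module R M] : Prop :=
  ∀ pr : MinPres R M, ∀ f : M →ₗ[R] pr.tau K, f = 0

/-- `N ∈ ⊥(τM)`, i.e. `Hom(N, τM) = 0`. -/
def InPerpTau (M : Type u) [AddCommGroup M] [Module R M]
    (N : Type u) [AddCommGroup N] [Module R N] : Prop :=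
  ∀ pr : MinPres R M, ∀ f : N →ₗ[R] pr.tau K, f = 0

/-- `M` is a τ-tilting module: τ-rigid with `|M| = |R|`. -/
def IsTauTilting (M : Type u) [AddCommGroup M] [Module R M] : Prop :=
  IsTauRigid R K M ∧ ∃ m l : ℕ, NumIndec R M m ∧ NumIndec R R l ∧ m = l

/-- `M` is τ⁻¹-rigid: `Hom(τ⁻¹M, M) = 0`, where `τ⁻¹M = Tr (D M)`.
A homomorphism `τ⁻¹M → M` is an additive map compatible with the identification
`R ≅ Rᵐᵒᵖᵐᵒᵖ` of scalars. -/
def IsTauInvRigid (M : Type u) [AddCommGroup M] [Module R M] [Module K M]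
    [IsScalarTower K R M] : Prop :=
  ∀ pr : MinPres Rᵐᵒᵖ (LDual R K M), ∀ f : pr.Tr →+ M,
    (∀ (r : R) (x : pr.Tr), f (op (op r) • x) = r • f x) → f = 0

/-- `M` is a τ⁻¹-tilting module. -/
def IsTauInvTilting (M : Type u) [AddCommGroup M] [Module R M] [Module K M]
    [IsScalarTower K R M] : Prop :=
  IsTauInvRigid R K M ∧ ∃ m l : ℕ, NumIndec R M m ∧ NumIndec R R l ∧ m = l

end Tau

section Pairs

variable (K : Type u) [Field K] (R : Type u) [Ring R] [Algebra K R]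

/-- A pair `(M, P)` of finitely generated modules (with compatible `K`-structure). -/
structure ModPair : Type (u + 1) where
  M : Type u
  [acgM : AddCommGroup M]
  [modM : Module R M]
  [modKM : Module K M]
  [towM : IsScalarTower K R M]
  finM : Module.Finite R M
  P : Type u
  [acgP : AddCommGroup P]
  [modP : Module R P]
  [modKP : Module K P]
  [towP : IsScalarTower K R P]
  finP : Module.Finite R P

attribute [instance] ModPair.acgM ModPair.modM ModPair.modKM ModPair.towM
attribute [instance] ModPair.acgP ModPair.modP ModPair.modKP ModPair.towP

variable {K R}

/-- Isomorphism of pairs. -/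
def ModPair.Iso (x y : ModPair K R) : Prop :=
  Nonempty (x.M ≃ₗ[R] y.M) ∧ Nonempty (x.P ≃ₗ[R] y.P)

variable (K R)

/-- The setoid of pairs satisfying a property `Q`, up to isomorphism. -/
def pairSetoid (Q : ModPair K R → Prop) : Setoid {x : ModPair K R // Q x} where
  r a b := ModPair.Iso a.1 b.1
  iseqv := by
    constructor
    · exact fun a => ⟨⟨LinearEquiv.refl R a.1.M⟩, ⟨LinearEquiv.refl R a.1.P⟩⟩
    · rintro a b ⟨⟨e⟩, ⟨e'⟩⟩; exact ⟨⟨e.symm⟩, ⟨e'.symm⟩⟩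
    · rintro a b c ⟨⟨e⟩, ⟨e'⟩⟩ ⟨⟨f⟩, ⟨f'⟩⟩; exact ⟨⟨e.trans f⟩, ⟨e'.trans f'⟩⟩

/-- `(M, P)` is a τ-rigid pair: `M` is τ-rigid, `P` is projective and `Hom(P, M) = 0`. -/
def IsTauRigidPair (x : ModPair K R) : Prop :=
  IsTauRigid R K x.M ∧ Module.Projective R x.P ∧ ∀ f : x.P →ₗ[R] x.M, f = 0

/-- A Gorenstein projective τ-rigid pair. -/
def IsGPTauRigidPair (x : ModPair K R) : Prop :=
  IsTauRigidPair K R x ∧ IsGP R x.M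

/-- A support τ-tilting pair: a τ-rigid pair with `|M| + |P| = |R|`. -/
def IsSuppTauTiltingPair (x : ModPair K R) : Prop :=
  IsTauRigidPair K R x ∧
    ∃ m p l : ℕ, NumIndec R x.M m ∧ NumIndec R x.P p ∧ NumIndec R R l ∧ m + p = l

/-- A Gorenstein projective support τ-tilting pair. -/
def IsGPSuppTauTiltingPair (x : ModPair K R) : Prop :=
  IsSuppTauTiltingPair K R x ∧ IsGP R x.M

/-- `(I, N)` is a τ⁻¹-rigid pair; here `x.M = N` is the module and `x.P = I` is
injective, with `Hom(N, I) = 0`. -/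
def IsTauInvRigidPair (x : ModPair K R) : Prop :=
  IsTauInvRigid R K x.M ∧ Module.Injective R x.P ∧ ∀ f : x.M →ₗ[R] x.P, f = 0

/-- A Gorenstein injective τ⁻¹-rigid pair. -/
def IsGITauInvRigidPair (x : ModPair K R) : Prop :=
  IsTauInvRigidPair K R x ∧ IsGI R K x.M

/-- A support τ⁻¹-tilting pair: a τ⁻¹-rigid pair with `|N| + |I| = |R|`. -/
def IsSuppTauInvTiltingPair (x : ModPair K R) : Prop :=
  IsTauInvRigidPair K R x ∧
    ∃ m p l : ℕ, NumIndec R x.M m ∧ NumIndec R x.P p ∧ NumIndec R R l ∧ m + p = l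

/-- A Gorenstein injective support τ⁻¹-tilting pair. -/
def IsGISuppTauInvTiltingPair (x : ModPair K R) : Prop :=
  IsSuppTauInvTiltingPair K R x ∧ IsGI R K x.M

/-- A basic pair. -/
def IsBasicPair (x : ModPair K R) : Prop := IsBasic R x.M ∧ IsBasic R x.P

/-- `y` is (a representative of) the dagger `(M, P)† = (Tr M_np ⊕ P*, M_p*)` of `x`,
where `M = M_p ⊕ M_np` with `M_p` a maximal projective direct summand. -/
def IsDaggerOf (x : ModPair K R) (y : ModPair K Rᵐᵒᵖ) : Prop :=
  ∃ Mp Mnp : Submodule R x.M, IsCompl Mp Mnp ∧ Module.Projective R Mp ∧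
    NoProjSummand R Mnp ∧
    ∃ pr : MinPres R Mnp,
      Nonempty (y.M ≃ₗ[Rᵐᵒᵖ] (pr.Tr × (x.P →ₗ[R] R))) ∧
      Nonempty (y.P ≃ₗ[Rᵐᵒᵖ] (Mp →ₗ[R] R))

/-- `y` is (a representative of) `D((M, P)†)`, the Gorenstein injective pair
`(D(M_p*), D(Tr M_np ⊕ P*))` associated to `x`; in our convention `y.M` is the
τ⁻¹-rigid module `D(Tr M_np ⊕ P*)` and `y.P` is the injective module `D(M_p*)`. -/
def IsDDaggerOf (x : ModPair K R) (y : ModPair K R) : Prop :=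
  ∃ z : ModPair K Rᵐᵒᵖ, IsDaggerOf K R x z ∧
    Nonempty (y.M ≃ₗ[R] OpDual R K z.M) ∧ Nonempty (y.P ≃ₗ[R] OpDual R K z.P)

end Pairs

section Support

variable (R : Type u) [Ring R] (K : Type u) [Field K] [Algebra K R]

/-- `φ : R →+* S` realizes `S` as the quotient of `R` by the two-sided ideal
generated by `e` (universal property). -/
def IsQuotientByIdem (e : R) (S : Type u) [Ring S] (φ : R →+* S) : Prop :=
  Function.Surjective φ ∧ φ e = 0 ∧
    ∀ (S' : Type u) (_ : Ring S') (ψ : R →+* S'), ψ e = 0 → ∃ χ : S →+* S', χ.comp φ = ψ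

/-- `M` is a support τ-tilting module: `M` is a τ-tilting module over `Λ/(e)` for
some idempotent `e`. -/
def IsSuppTauTilting (M : Type u) [AddCommGroup M] [Module R M] : Prop :=
  ∃ e : R, IsIdempotentElem e ∧
    ∃ (S : Type u) (_ : Ring S) (_ : Algebra K S) (φ : R →+* S),
      (∀ k : K, φ (algebraMap K R k) = algebraMap K S k) ∧
      IsQuotientByIdem R e S φ ∧
      ∃ _ : Module S M, (∀ (r : R) (m : M), φ r • m = r • m) ∧ IsTauTilting S K M

/-- `M` is a support τ⁻¹-tilting module: `M` is a τ⁻¹-tilting module over `Λ/(e)`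
for some idempotent `e`. -/
def IsSuppTauInvTilting (M : Type u) [AddCommGroup M] [Module R M] [Module K M] : Prop :=
  ∃ e : R, IsIdempotentElem e ∧
    ∃ (S : Type u) (_ : Ring S) (_ : Algebra K S) (φ : R →+* S),
      (∀ k : K, φ (algebraMap K R k) = algebraMap K S k) ∧
      IsQuotientByIdem R e S φ ∧
      ∃ _ : Module S M, (∀ (r : R) (m : M), φ r • m = r • m) ∧
        ∃ _ : IsScalarTower K S M, IsTauInvTilting S K M

end Support

section Torsion

variable (R : Type u) [Ring R]

/-- A class of modules is closed under isomorphism. -/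
def RespectsIso (T : ModuleCat.{u} R → Prop) : Prop :=
  ∀ X Y : ModuleCat.{u} R, Nonempty (X ≃ₗ[R] Y) → T X → T Y

/-- `(T, F)` is a torsion pair in the category of finitely generated `R`-modules. -/
def IsTorsionPair (T F : ModuleCat.{u} R → Prop) : Prop :=
  RespectsIso R T ∧ RespectsIso R F ∧
  (∀ X, T X → Module.Finite R X) ∧ (∀ X, F X → Module.Finite R X) ∧
  (∀ X Y : ModuleCat.{u} R, T X → F Y → ∀ f : X →ₗ[R] Y, f = 0) ∧
  (∀ X : ModuleCat.{u} R, Module.Finite R X →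
    ∃ t : Submodule R X, T (ModuleCat.of R t) ∧ F (ModuleCat.of R (X ⧸ t)))

/-- `T` is covariantly finite: every finitely generated module admits a left
`T`-approximation. -/
def CovariantlyFinite (T : ModuleCat.{u} R → Prop) : Prop :=
  ∀ X : ModuleCat.{u} R, Module.Finite R X →
    ∃ (M : ModuleCat.{u} R) (f : X →ₗ[R] M), T M ∧
      ∀ (M' : ModuleCat.{u} R) (g : X →ₗ[R] M'), T M' → ∃ h : M →ₗ[R] M', h.comp f = g

/-- `T` is contravariantly finite: every finitely generated module admits a right
`T`-approximation. -/
def ContravariantlyFinite (T : ModuleCat.{u} R → Prop) : Prop :=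
  ∀ X : ModuleCat.{u} R, Module.Finite R X →
    ∃ (M : ModuleCat.{u} R) (f : M →ₗ[R] X), T M ∧
      ∀ (M' : ModuleCat.{u} R) (g : M' →ₗ[R] X), T M' → ∃ h : M' →ₗ[R] M, f.comp h = g

/-- A functorially finite class. -/
def FunctoriallyFinite (T : ModuleCat.{u} R → Prop) : Prop :=
  CovariantlyFinite R T ∧ ContravariantlyFinite R T

/-- `G` is the basic Ext-projective generator of the torsion class `T`:
`G ∈ T` is basic, Ext-projective in `T`, `T = Fac G`, and every Ext-projective
module in `T` lies in `add G`. -/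
def IsBasicExtProjGen (T : ModuleCat.{u} R → Prop) (G : ModuleCat.{u} R) : Prop :=
  T G ∧ IsBasic R G ∧ (∀ X : ModuleCat.{u} R, T X → Ext1Vanishes R G X) ∧
  (∀ X : ModuleCat.{u} R, T X ↔ (Module.Finite R X ∧ FacOf R G X)) ∧
  (∀ X : ModuleCat.{u} R, T X → (∀ Y : ModuleCat.{u} R, T Y → Ext1Vanishes R X Y) →
    InAdd R G X)

/-- `C` is the basic Ext-injective cogenerator of the torsion-free class `F`:
`C ∈ F` is basic, Ext-injective in `F`, `F = Sub C`, and every Ext-injective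
module in `F` lies in `add C`. -/
def IsBasicExtInjCogen (F : ModuleCat.{u} R → Prop) (C : ModuleCat.{u} R) : Prop :=
  F C ∧ IsBasic R C ∧ (∀ X : ModuleCat.{u} R, F X → Ext1Vanishes R X C) ∧
  (∀ X : ModuleCat.{u} R, F X ↔ (Module.Finite R X ∧ SubOf R C X)) ∧
  (∀ X : ModuleCat.{u} R, F X → (∀ Y : ModuleCat.{u} R, F Y → Ext1Vanishes R Y X) →
    InAdd R C X)

variable (K : Type u) [Field K] [Algebra K R]

/-- A (functorially finite) Gorenstein torsion pair: the basic Ext-projective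
generator of `T` is Gorenstein projective. -/
def IsGorensteinTP (T F : ModuleCat.{u} R → Prop) : Prop :=
  IsTorsionPair R T F ∧ FunctoriallyFinite R T ∧
    ∀ G : ModuleCat.{u} R, IsBasicExtProjGen R T G → IsGP R G

/-- A trivial torsion pair: the basic Ext-projective generator of `T` is projective. -/
def IsTrivialTP (T F : ModuleCat.{u} R → Prop) : Prop :=
  IsTorsionPair R T F ∧ FunctoriallyFinite R T ∧
    ∀ G : ModuleCat.{u} R, IsBasicExtProjGen R T G → Module.Projective R G

end Torsion

section Misc

variable (R : Type u) [Ring R] (K : Type u) [Field K] [Algebra K R]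

/-- A projective cover `π : P → M`. -/
structure ProjCover (M : Type u) [AddCommGroup M] [Module R M] : Type (u + 1) where
  P : Type u
  [acg : AddCommGroup P]
  [mod : Module R P]
  fin : Module.Finite R P
  proj : Module.Projective R P
  π : P →ₗ[R] M
  surj : Function.Surjective π
  min : IsSuperfluous R (LinearMap.ker π)

attribute [instance] ProjCover.acg ProjCover.mod

/-- The canonical evaluation map `M → M** = Hom_{Rᵐᵒᵖ}(Hom_R(M, R), Rᵐᵒᵖ)`. -/
def bidualEval (M : Type u) [AddCommGroup M] [Module R M] (m : M) :
    (M →ₗ[R] R) →ₗ[Rᵐᵒᵖ] Rᵐᵒᵖ where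
  toFun f := op (f m)
  map_add' f g := by simp
  map_smul' s f := rfl

/-- `R` is CM-τ-tilting finite: up to isomorphism there are only finitely many
indecomposable Gorenstein projective τ-rigid modules. -/
def CMTauTiltingFinite : Prop :=
  ∃ (n : ℕ) (V : Fin n → ModuleCat.{u} R),
    ∀ (M : Type u) [AddCommGroup M] [Module R M], Module.Finite R M →
      IsIndec R M → IsGP R M → IsTauRigid R K M → ∃ i, Nonempty (M ≃ₗ[R] V i)

/-- `R` is CM-finite: up to isomorphism there are only finitely many
indecomposable Gorenstein projective modules. -/
def CMFinite : Prop :=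
  ∃ (n : ℕ) (V : Fin n → ModuleCat.{u} R),
    ∀ (M : Type u) [AddCommGroup M] [Module R M], Module.Finite R M →
      IsIndec R M → IsGP R M → ∃ i, Nonempty (M ≃ₗ[R] V i)

/-- `T` is the Bongartz completion of the τ-rigid module `M`: the basic
Ext-projective generator of `⊥(τM)`, with `⊥(τM) = Fac T`. -/
def IsBongartzCompletion (M : Type u) [AddCommGroup M] [Module R M]
    (T : Type u) [AddCommGroup T] [Module R T] : Prop :=
  Module.Finite R T ∧ IsBasic R T ∧ InPerpTau R K M T ∧
  (∀ (X : Type u) [AddCommGroup X] [Module R X], Module.Finite R X →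
    InPerpTau R K M X → Ext1Vanishes R T X) ∧
  (∀ (X : Type u) [AddCommGroup X] [Module R X], Module.Finite R X →
    (InPerpTau R K M X ↔ FacOf R T X))

end Misc

section Dual

variable {R : Type u} [Ring R]

/-- The `R`-dual of a linear map, as a map of `Rᵐᵒᵖ`-modules. -/
def dualHom {P Q : Type u} [AddCommGroup P] [Module R P] [AddCommGroup Q] [Module R Q]
    (d : P →ₗ[R] Q) : (Q →ₗ[R] R) →ₗ[Rᵐᵒᵖ] (P →ₗ[R] R) where
  toFun g := g.comp d
  map_add' _ _ := rfl
  map_smul' _ _ := rfl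

/-- The cokernel of the dual of a linear map. -/
abbrev CokerDual {P Q : Type u} [AddCommGroup P] [Module R P] [AddCommGroup Q] [Module R Q]
    (d : P →ₗ[R] Q) : Type u := (P →ₗ[R] R) ⧸ LinearMap.range (dualHom d)

variable {P Q : Type u} [AddCommGroup P] [Module R P] [AddCommGroup Q] [Module R Q]

lemma dualHom_apply (d : P →ₗ[R] Q) (g : Q →ₗ[R] R) : dualHom d g = g.comp d := rfl

variable (R) in
/-- Finitely generated projective modules have finite dual bases. -/
lemma exists_dualBasis (P : Type u) [AddCommGroup P] [Module R P] [Module.Finite R P]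
    [Module.Projective R P] : ∃ (n : ℕ) (e : Fin n → P) (ε : Fin n → P →ₗ[R] R),
      (∀ x, ∑ j, ε j x • e j = x) ∧ ∀ f : P →ₗ[R] R, ∑ j, op (f (e j)) • ε j = f := by
  obtain ⟨n, f, g, -, -, hfg⟩ := Module.Finite.exists_comp_eq_id_of_projective R P
  have key : ∀ x, ∑ j, (LinearMap.proj j ∘ₗ g) x • f (Pi.single j 1) = x := by
    intro x
    have := LinearMap.congr_fun hfg x
    conv_rhs => rw [← LinearMap.id_apply (R := R) x, ← this]
    rw [LinearMap.comp_apply, ← Finset.univ_sum_single (g x), map_sum]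
    refine Finset.sum_congr rfl fun j _ => ?_
    rw [← map_smul]
    congr 1
    ext k
    by_cases h : k = j
    · subst h; simp
    · simp [h]
  refine ⟨n, fun j => f (Pi.single j 1), fun j => LinearMap.proj j ∘ₗ g, key, fun h => ?_⟩
  ext x
  conv_rhs => rw [← key x]
  simp [LinearMap.sum_apply]

lemma eq_zero_of_forall_dual [Module.Finite R P] [Module.Projective R P] {x : P}
    (h : ∀ f : P →ₗ[R] R, f x = 0) : x = 0 := by
  obtain ⟨n, e, ε, h1, -⟩ := exists_dualBasis R P
  rw [← h1 x]
  simp [h]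

lemma exists_eval [Module.Finite R P] [Module.Projective R P]
    (φ : (P →ₗ[R] R) →ₗ[Rᵐᵒᵖ] Rᵐᵒᵖ) : ∃ x : P, ∀ f, φ f = op (f x) := by
  obtain ⟨n, e, ε, -, h2⟩ := exists_dualBasis R P
  refine ⟨∑ j, unop (φ (ε j)) • e j, fun f => ?_⟩
  conv_lhs => rw [← h2 f]
  simp

lemma dualHom_surjective [Module.Finite R P] [Module.Projective R P]
    [Module.Finite R Q] [Module.Projective R Q]
    (φ : (Q →ₗ[R] R) →ₗ[Rᵐᵒᵖ] (P →ₗ[R] R)) : ∃ α : P →ₗ[R] Q, φ = dualHom α := by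
  obtain ⟨n, e, ε, -, h2⟩ := exists_dualBasis R Q
  refine ⟨∑ j, (φ (ε j)).smulRight (e j), LinearMap.ext fun f => ?_⟩
  conv_lhs => rw [← h2 f]
  ext x
  simp [dualHom_apply]

lemma dualHom_injective [Module.Finite R Q] [Module.Projective R Q] {α β : P →ₗ[R] Q}
    (h : dualHom α = dualHom β) : α = β := by
  ext x
  rw [← sub_eq_zero]
  refine eq_zero_of_forall_dual (R := R) fun f => ?_
  rw [map_sub, sub_eq_zero]
  exact LinearMap.congr_fun (LinearMap.congr_fun h f) x

instance finite_dual [Module.Finite R P] [Module.Projective R P] :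
    Module.Finite Rᵐᵒᵖ (P →ₗ[R] R) := by
  obtain ⟨n, e, ε, -, h2⟩ := exists_dualBasis R P
  refine Module.Finite.of_surjective (Fintype.linearCombination Rᵐᵒᵖ ε) fun f => ?_
  exact ⟨fun j => op (f (e j)), by simpa [Fintype.linearCombination_apply] using h2 f⟩

instance projective_dual [Module.Finite R P] [Module.Projective R P] :
    Module.Projective Rᵐᵒᵖ (P →ₗ[R] R) := by
  obtain ⟨n, e, ε, -, h2⟩ := exists_dualBasis R P
  refine Module.Projective.of_split (M := Fin n → Rᵐᵒᵖ)
    { toFun := fun f j => op (f (e j)), map_add' := fun f g => rfl, map_smul' := fun s f => rfl }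
    (Fintype.linearCombination Rᵐᵒᵖ ε) ?_
  ext1 f
  simpa [Fintype.linearCombination_apply] using h2 f

end Dual

section CokerDual

variable {R : Type u} [Ring R]
variable {P₁ P₀ Q₁ Q₀ : Type u} [AddCommGroup P₁] [Module R P₁] [AddCommGroup P₀] [Module R P₀]
  [AddCommGroup Q₁] [Module R Q₁] [AddCommGroup Q₀] [Module R Q₀]

/-- The projection onto the cokernel of the dual map. -/
abbrev cokerDualMk (d : P₁ →ₗ[R] P₀) : (P₁ →ₗ[R] R) →ₗ[Rᵐᵒᵖ] CokerDual d :=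
  (LinearMap.range (dualHom d)).mkQ

lemma cokerDualMk_surjective (d : P₁ →ₗ[R] P₀) : Surjective (cokerDualMk d) :=
  Submodule.mkQ_surjective _

lemma cokerDualMk_eq_zero_iff (d : P₁ →ₗ[R] P₀) (h : P₁ →ₗ[R] R) :
    cokerDualMk d h = 0 ↔ ∃ g : P₀ →ₗ[R] R, g.comp d = h := by
  rw [Submodule.mkQ_apply, Submodule.Quotient.mk_eq_zero]
  exact Iff.rfl

lemma exact_dualHom_cokerDualMk (d : P₁ →ₗ[R] P₀) : Exact (dualHom d) (cokerDualMk d) :=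
  fun h => cokerDualMk_eq_zero_iff d h

/-- Maps between cokernels of dual maps lift to maps of two-term complexes. -/
lemma exists_lift_cokerDual [Module.Finite R P₁] [Module.Projective R P₁]
    [Module.Finite R P₀] [Module.Projective R P₀] [Module.Finite R Q₁] [Module.Projective R Q₁]
    [Module.Finite R Q₀] [Module.Projective R Q₀]
    (d : P₁ →ₗ[R] P₀) (d' : Q₁ →ₗ[R] Q₀) (θ : CokerDual d →ₗ[Rᵐᵒᵖ] CokerDual d') :
    ∃ (α₁ : Q₁ →ₗ[R] P₁) (α₀ : Q₀ →ₗ[R] P₀), d.comp α₁ = α₀.comp d' ∧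
      ∀ h, θ (cokerDualMk d h) = cokerDualMk d' (h.comp α₁) := by
  obtain ⟨φ₁, hφ₁⟩ := Module.projective_lifting_property (cokerDualMk d')
    (θ.comp (cokerDualMk d)) (cokerDualMk_surjective d')
  obtain ⟨α₁, rfl⟩ := dualHom_surjective φ₁
  have hθ : ∀ h, θ (cokerDualMk d h) = cokerDualMk d' (h.comp α₁) := fun h =>
    (LinearMap.congr_fun hφ₁ h).symm
  have hmem : ∀ g : P₀ →ₗ[R] R, dualHom α₁ (dualHom d g) ∈ LinearMap.range (dualHom d') := by
    intro g
    have := hθ (g.comp d)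
    rw [(cokerDualMk_eq_zero_iff d _).2 ⟨g, rfl⟩, map_zero] at this
    exact (cokerDualMk_eq_zero_iff d' _).1 this.symm
  obtain ⟨φ₀, hφ₀⟩ := Module.projective_lifting_property (dualHom d').rangeRestrict
    (((dualHom α₁).comp (dualHom d)).codRestrict _ hmem) (LinearMap.surjective_rangeRestrict _)
  obtain ⟨α₀, rfl⟩ := dualHom_surjective φ₀
  refine ⟨α₁, α₀, dualHom_injective (LinearMap.ext fun g => ?_), hθ⟩
  have := congrArg Subtype.val (LinearMap.congr_fun hφ₀ g)
  exact this.symm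

end CokerDual

section Minimal

variable {R : Type u} [Ring R]

/-- Given a surjection `p`, a map killing its kernel factors through it. -/
lemma exists_descent {A B C : Type u} [AddCommGroup A] [Module R A] [AddCommGroup B] [Module R B]
    [AddCommGroup C] [Module R C] {p : A →ₗ[R] B} (hp : Surjective p) (f : A →ₗ[R] C)
    (h : ∀ x, p x = 0 → f x = 0) : ∃ g : B →ₗ[R] C, g.comp p = f := by
  refine ⟨((LinearMap.ker p).liftQ f h).comp (p.quotKerEquivOfSurjective hp).symm.toLinearMap, ?_⟩
  ext x
  have : (p.quotKerEquivOfSurjective hp).symm (p x) = Submodule.Quotient.mk x := by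
    rw [LinearEquiv.symm_apply_eq]; rfl
  simp only [LinearMap.comp_apply, LinearEquiv.coe_coe, this]
  exact Submodule.liftQ_apply _ _ _

/-- **Fitting's lemma** for indecomposable modules of finite length. -/
lemma IsIndec.bijective_or {M : Type u} [AddCommGroup M] [Module R M] [IsNoetherian R M]
    [IsArtinian R M] (hM : IsIndec R M) (e : M →ₗ[R] M) :
    Bijective e ∨ Bijective (LinearMap.id - e : M →ₗ[R] M) := by
  obtain ⟨n, hn, hn0⟩ := ((LinearMap.eventually_isCompl_ker_pow_range_pow e).and
    (Filter.eventually_ge_atTop 1)).exists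
  rcases hM.2 _ _ hn with h | h
  · left
    refine IsArtinian.bijective_of_injective_endomorphism e ?_
    have h1 : Injective (e ^ n) := LinearMap.ker_eq_bot.1 h
    obtain ⟨k, rfl⟩ : ∃ k, n = k + 1 := ⟨n - 1, by omega⟩
    rw [pow_succ, Module.End.mul_eq_comp, LinearMap.coe_comp] at h1
    exact h1.of_comp
  · right
    have h1 : IsNilpotent (show Module.End R M from e) := ⟨n, LinearMap.range_eq_bot.1 h⟩
    exact (Module.End.isUnit_iff _).1 h1.isUnit_one_sub

lemma IsIndec.of_idempotent {M : Type u} [AddCommGroup M] [Module R M] [Nontrivial M]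
    (h : ∀ e : M →ₗ[R] M, e.comp e = e → Surjective e ∨
      Surjective (LinearMap.id - e : M →ₗ[R] M)) : IsIndec R M := by
  refine ⟨inferInstance, fun N₁ N₂ hc => ?_⟩
  have hid := Submodule.isIdempotentElem_projection hc
  rcases h (N₁.projection N₂ hc) hid with h | h
  · right
    rw [eq_bot_iff]
    intro x hx
    have h0 : (N₁.projection N₂ hc) x = 0 := (Submodule.projection_apply_eq_zero_iff hc).2 hx
    obtain ⟨y, rfl⟩ := h x
    have := LinearMap.congr_fun hid y
    rw [Module.End.mul_apply, h0] at this
    simpa using this.symm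
  · left
    rw [eq_bot_iff]
    intro x hx
    obtain ⟨y, rfl⟩ := h x
    have h1 := Submodule.projection_apply_of_mem_left hc hx
    rw [LinearMap.sub_apply, LinearMap.id_apply, map_sub] at h1
    have h2 := LinearMap.congr_fun hid y
    rw [Module.End.mul_apply] at h2
    rw [h2, sub_self] at h1
    simpa using h1.symm

lemma IsIndec.idempotent {M : Type u} [AddCommGroup M] [Module R M] (hM : IsIndec R M)
    (e : M →ₗ[R] M) (he : e.comp e = e) : e = 0 ∨ e = LinearMap.id := by
  have hc : IsCompl (LinearMap.ker e) (LinearMap.range e) :=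
    (LinearMap.IsIdempotentElem.isCompl (f := e) he).symm
  rcases hM.2 _ _ hc with h | h
  · right
    ext x
    refine LinearMap.ker_eq_bot.1 h ?_
    exact LinearMap.congr_fun he x
  · exact Or.inl (LinearMap.range_eq_bot.1 h)

/-- A retract of an indecomposable module is zero or the whole module. -/
lemma IsIndec.bijective_of_retract {M N : Type u} [AddCommGroup M] [Module R M] [AddCommGroup N]
    [Module R N] [Nontrivial M] (hN : IsIndec R N) {i : M →ₗ[R] N} {p : N →ₗ[R] M}
    (h : p.comp i = LinearMap.id) : Bijective i := by
  have h' := LinearMap.congr_fun h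
  have hinj : Injective i := LeftInverse.injective (g := p) h'
  refine ⟨hinj, ?_⟩
  rcases hN.idempotent (i.comp p) (by ext x; simpa using congrArg i (h' (p x))) with h0 | h1
  · exfalso
    obtain ⟨x, hx⟩ := exists_ne (0 : M)
    apply hx
    have h2 := LinearMap.congr_fun h0 (i x)
    have h3 : p (i x) = x := h' x
    have h4 : i x = 0 := by simpa [h3] using h2
    rw [← h3, h4, map_zero]
  · exact fun y => ⟨p y, LinearMap.congr_fun h1 y⟩

variable {M : Type u} [AddCommGroup M] [Module R M]

attribute [instance] MinPres.fin₁ MinPres.fin₀ MinPres.proj₁ MinPres.proj₀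

lemma surjective_of_superfluous {A B : Type u} [AddCommGroup A] [Module R A] [AddCommGroup B]
    [Module R B] {p : A →ₗ[R] B} (hp : IsSuperfluous R (LinearMap.ker p)) {f : A →ₗ[R] A}
    (h : ∀ x, ∃ y, p (f y) = p x) : Surjective f := by
  rw [← LinearMap.range_eq_top]
  apply hp
  rw [eq_top_iff]
  intro x _
  obtain ⟨y, hy⟩ := h x
  have : x = (x - f y) + f y := by abel
  rw [this]
  exact Submodule.add_mem_sup (by simp [hy]) ⟨y, rfl⟩

/-- An endomorphism of a minimal presentation inducing an automorphism is an automorphism. -/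
lemma MinPres.bijective_of_comm [IsArtinianRing R] (pr : MinPres R M)
    {α₁ : pr.P₁ →ₗ[R] pr.P₁} {α₀ : pr.P₀ →ₗ[R] pr.P₀} (h : pr.d.comp α₁ = α₀.comp pr.d)
    {e : M →ₗ[R] M} (he : pr.p.comp α₀ = e.comp pr.p) (hb : Bijective e) :
    Bijective α₁ ∧ Bijective α₀ := by
  have h0 : Surjective α₀ := by
    refine surjective_of_superfluous pr.min₀ fun x => ?_
    obtain ⟨m, hm⟩ := hb.2 (pr.p x)
    obtain ⟨y, rfl⟩ := pr.surj m
    exact ⟨y, (LinearMap.congr_fun he y).trans hm⟩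
  have h1 : Surjective α₁ := by
    refine surjective_of_superfluous pr.min₁ fun x => ?_
    obtain ⟨z, hz⟩ := h0 (pr.d x)
    have h2 : e (pr.p z) = 0 := by
      rw [← LinearMap.comp_apply, ← he, LinearMap.comp_apply, hz]
      exact pr.exact.apply_apply_eq_zero x
    have h3 : pr.p z = 0 := hb.1 (by rw [h2, map_zero])
    obtain ⟨w, rfl⟩ := (pr.exact z).1 h3
    exact ⟨w, (LinearMap.congr_fun h w).trans hz⟩
  exact ⟨IsNoetherian.bijective_of_surjective_endomorphism _ h1,
    IsNoetherian.bijective_of_surjective_endomorphism _ h0⟩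

/-- Endomorphisms of a presentation induce endomorphisms of the presented module. -/
lemma exists_induced {P₁ P₀ Q₁ Q₀ N : Type u} [AddCommGroup P₁] [Module R P₁] [AddCommGroup P₀]
    [Module R P₀] [AddCommGroup Q₁] [Module R Q₁] [AddCommGroup Q₀] [Module R Q₀]
    [AddCommGroup N] [Module R N] {d : P₁ →ₗ[R] P₀} {p : P₀ →ₗ[R] M} {d' : Q₁ →ₗ[R] Q₀}
    {p' : Q₀ →ₗ[R] N} (hp : Surjective p) (hd : Exact d p) (hd' : Exact d' p')
    {α₁ : P₁ →ₗ[R] Q₁} {α₀ : P₀ →ₗ[R] Q₀} (h : d'.comp α₁ = α₀.comp d) :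
    ∃ e : M →ₗ[R] N, p'.comp α₀ = e.comp p := by
  obtain ⟨e, he⟩ := exists_descent hp (p'.comp α₀) (fun x hx => by
    obtain ⟨y, rfl⟩ := (hd x).1 hx
    have : α₀ (d y) = d' (α₁ y) := (LinearMap.congr_fun h y).symm
    simp [this, hd'.apply_apply_eq_zero])
  exact ⟨e, he.symm⟩

/-- Maps between presented modules lift to presentations. -/
lemma exists_lift_presentation {P₁ P₀ Q₁ Q₀ N : Type u} [AddCommGroup P₁] [Module R P₁]
    [AddCommGroup P₀] [Module R P₀] [AddCommGroup Q₁] [Module R Q₁] [AddCommGroup Q₀] [Module R Q₀]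
    [AddCommGroup N] [Module R N] [Module.Projective R P₁] [Module.Projective R P₀]
    {d : P₁ →ₗ[R] P₀} {p : P₀ →ₗ[R] M} {d' : Q₁ →ₗ[R] Q₀} {p' : Q₀ →ₗ[R] N}
    (hd : Exact d p) (hp' : Surjective p') (hd' : Exact d' p') (e : M →ₗ[R] N) :
    ∃ (α₁ : P₁ →ₗ[R] Q₁) (α₀ : P₀ →ₗ[R] Q₀), d'.comp α₁ = α₀.comp d ∧ p'.comp α₀ = e.comp p := by
  obtain ⟨α₀, h0⟩ := Module.projective_lifting_property p' (e.comp p) hp'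
  have hmem : ∀ x, (α₀.comp d) x ∈ LinearMap.range d' := fun x => by
    apply (hd' _).1
    rw [LinearMap.comp_apply, ← LinearMap.comp_apply, h0]
    simp [hd.apply_apply_eq_zero]
  obtain ⟨α₁, h1⟩ := Module.projective_lifting_property d'.rangeRestrict
    ((α₀.comp d).codRestrict _ hmem) (LinearMap.surjective_rangeRestrict _)
  exact ⟨α₁, α₀, LinearMap.ext fun x => congrArg Subtype.val (LinearMap.congr_fun h1 x), h0⟩

/-- A minimal presentation is a retract of every presentation. -/
lemma MinPres.exists_retract [IsArtinianRing R] (pr : MinPres R M) {Q₁ Q₀ : Type u}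
    [AddCommGroup Q₁] [Module R Q₁] [AddCommGroup Q₀] [Module R Q₀] [Module.Projective R Q₁]
    [Module.Projective R Q₀] {d : Q₁ →ₗ[R] Q₀} {p : Q₀ →ₗ[R] M} (hp : Surjective p)
    (hd : Exact d p) :
    ∃ (u₁ : pr.P₁ →ₗ[R] Q₁) (u₀ : pr.P₀ →ₗ[R] Q₀) (v₁ : Q₁ →ₗ[R] pr.P₁) (v₀ : Q₀ →ₗ[R] pr.P₀),
      d.comp u₁ = u₀.comp pr.d ∧ pr.d.comp v₁ = v₀.comp d ∧ Bijective (v₁.comp u₁) ∧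
      p.comp u₀ = pr.p := by
  obtain ⟨u₁, u₀, hu, hu'⟩ := exists_lift_presentation pr.exact hp hd (LinearMap.id (M := M))
  obtain ⟨v₁, v₀, hv, hv'⟩ :=
    exists_lift_presentation hd pr.surj pr.exact (LinearMap.id (M := M))
  refine ⟨u₁, u₀, v₁, v₀, hu, hv, (pr.bijective_of_comm (α₀ := v₀.comp u₀) ?_ (e := LinearMap.id)
    ?_ bijective_id).1, hu'⟩
  · rw [← LinearMap.comp_assoc, hv, LinearMap.comp_assoc, hu, LinearMap.comp_assoc]
  · rw [← LinearMap.comp_assoc, hv', LinearMap.comp_assoc, hu']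
    rfl

/-- Projective covers exist over Artinian rings. -/
lemma exists_superfluous_cover [IsArtinianRing R] (M : Type u) [AddCommGroup M] [Module R M]
    [Module.Finite R M] : ∃ (P : Type u) (_ : AddCommGroup P) (_ : Module R P)
      (p : P →ₗ[R] M), Module.Finite R P ∧ Module.Projective R P ∧ Surjective p ∧
      IsSuperfluous R (LinearMap.ker p) := by
  obtain ⟨n, f, hf⟩ := Module.Finite.exists_fin' R M
  obtain ⟨N, ⟨⟨r, hr⟩, hN⟩, hmin⟩ := wellFounded_lt.has_min
    {N : Submodule R (Fin n → R) | (∃ r : (Fin n → R) →ₗ[R] N, r.comp N.subtype = LinearMap.id) ∧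
      ∀ m, ∃ x ∈ N, f x = m}
    ⟨⊤, ⟨LinearMap.codRestrict ⊤ LinearMap.id (fun _ => trivial), rfl⟩,
      fun m => (hf m).imp fun x hx => ⟨trivial, hx⟩⟩
  have hproj : Module.Projective R N := Module.Projective.of_split _ _ hr
  refine ⟨N, inferInstance, inferInstance, f.comp N.subtype, inferInstance, hproj, ?_, ?_⟩
  · intro m
    obtain ⟨x, hx, h⟩ := hN m
    exact ⟨⟨x, hx⟩, h⟩
  · intro N' hN'
    have hsurj : Surjective ((f.comp N.subtype).comp N'.subtype) := by
      intro m
      obtain ⟨x, hx, rfl⟩ := hN m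
      have : (⟨x, hx⟩ : N) ∈ LinearMap.ker (f.comp N.subtype) ⊔ N' := hN' ▸ trivial
      obtain ⟨y, hy, z, hz, hyz⟩ := Submodule.mem_sup.1 this
      refine ⟨⟨z, hz⟩, ?_⟩
      have h1 : f x = (f.comp N.subtype) ⟨x, hx⟩ := rfl
      rw [h1, ← hyz, map_add, LinearMap.mem_ker.1 hy, zero_add]; rfl
    obtain ⟨g, hg⟩ := Module.projective_lifting_property _ (f.comp N.subtype) hsurj
    set e : N →ₗ[R] N := N'.subtype.comp g with he
    have hfe : (f.comp N.subtype).comp e = f.comp N.subtype := hg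
    obtain ⟨k, hk, hk0⟩ := ((LinearMap.eventually_isCompl_ker_pow_range_pow e).and
      (Filter.eventually_ge_atTop 1)).exists
    have hfk : ∀ j : ℕ, (f.comp N.subtype).comp (e ^ j) = f.comp N.subtype := by
      intro j
      induction j with
      | zero => rfl
      | succ j ih =>
        rw [pow_succ, Module.End.mul_eq_comp, ← LinearMap.comp_assoc, ih, hfe]
    have hle : LinearMap.range (e ^ k) ≤ N' := by
      obtain ⟨l, rfl⟩ : ∃ l, k = l + 1 := ⟨k - 1, by omega⟩
      rintro _ ⟨x, rfl⟩
      rw [pow_succ', Module.End.mul_apply]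
      exact (g _).2
    have hmap : ¬ (LinearMap.range (e ^ k)).map N.subtype < N := by
      refine hmin _ ⟨?_, fun m => ?_⟩
      · have hinj : Injective N.subtype := Subtype.val_injective
        let E := Submodule.equivMapOfInjective N.subtype hinj (LinearMap.range (e ^ k))
        refine ⟨E.toLinearMap.comp ((Submodule.projectionOnto _ _ hk.symm).comp r), ?_⟩
        ext1 x
        obtain ⟨y, rfl⟩ := E.surjective x
        have h1 : r (N.subtype (y : N)) = y := LinearMap.congr_fun hr _
        have h2 : ((E y : (LinearMap.range (e ^ k)).map N.subtype) : Fin n → R) =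
          N.subtype (y : N) := rfl
        simp only [LinearMap.comp_apply, Submodule.subtype_apply, LinearMap.id_apply,
          LinearEquiv.coe_coe]
        rw [h2, h1, Submodule.projectionOnto_apply_left]
      · obtain ⟨x, hx, rfl⟩ := hN m
        exact ⟨_, ⟨_, ⟨⟨x, hx⟩, rfl⟩, rfl⟩, LinearMap.congr_fun (hfk k) ⟨x, hx⟩⟩
    have heq := eq_of_le_of_not_lt (Submodule.map_subtype_le _ _) hmap
    rw [eq_top_iff]
    intro x _
    have hx : (x : Fin n → R) ∈ (LinearMap.range (e ^ k)).map N.subtype := by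
      rw [heq]; exact x.2
    obtain ⟨y, hy, hxy⟩ := hx
    exact hle (Subtype.ext hxy ▸ hy)

lemma nonempty_minPres [IsArtinianRing R] (M : Type u) [AddCommGroup M] [Module R M]
    [Module.Finite R M] : Nonempty (MinPres R M) := by
  obtain ⟨P₀, _, _, p, hf₀, hp₀, hs₀, hm₀⟩ := exists_superfluous_cover (R := R) M
  obtain ⟨P₁, _, _, q, hf₁, hp₁, hs₁, hm₁⟩ :=
    exists_superfluous_cover (R := R) (LinearMap.ker p)
  refine ⟨{ P₁ := P₁, P₀ := P₀, fin₁ := hf₁, fin₀ := hf₀, proj₁ := hp₁, proj₀ := hp₀,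
            d := (LinearMap.ker p).subtype.comp q, p := p, surj := hs₀, exact := ?_,
            min₀ := hm₀, min₁ := ?_ }⟩
  · rw [LinearMap.exact_iff, LinearMap.range_comp, LinearMap.range_eq_top.2 hs₁]
    simp
  · rwa [LinearMap.ker_comp_of_ker_eq_bot _ (Submodule.ker_subtype _)]

end Minimal

section Transpose

variable {R : Type u} [Ring R] {M : Type u} [AddCommGroup M] [Module R M]

lemma projective_of_subsingleton_cokerDual {P₁ P₀ : Type u} [AddCommGroup P₁] [Module R P₁]
    [AddCommGroup P₀] [Module R P₀] [Module.Finite R P₁] [Module.Projective R P₁]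
    [Module.Finite R P₀] [Module.Projective R P₀] {d : P₁ →ₗ[R] P₀} {p : P₀ →ₗ[R] M}
    (hp : Surjective p) (hd : Exact d p) [Subsingleton (CokerDual d)] :
    Module.Projective R M := by
  have hs : Surjective (dualHom d) := fun h =>
    (cokerDualMk_eq_zero_iff d h).1 (Subsingleton.elim _ _)
  obtain ⟨σ, hσ⟩ := Module.projective_lifting_property (dualHom d) LinearMap.id hs
  obtain ⟨β, rfl⟩ := dualHom_surjective σ
  have hβ : β.comp d = LinearMap.id := dualHom_injective hσ
  obtain ⟨s, hs⟩ := exists_descent hp (LinearMap.id - d.comp β) (fun x hx => by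
    obtain ⟨y, rfl⟩ := (hd x).1 hx
    have : β (d y) = y := LinearMap.congr_fun hβ y
    simp [this])
  refine Module.Projective.of_split s p ?_
  ext m
  obtain ⟨x, rfl⟩ := hp m
  have := congrArg p (LinearMap.congr_fun hs x)
  simpa [hd.apply_apply_eq_zero] using this

lemma MinPres.surjective_of_comm [IsArtinianRing R] (pr : MinPres R M)
    {α₁ : pr.P₁ →ₗ[R] pr.P₁} {α₀ : pr.P₀ →ₗ[R] pr.P₀} (h : pr.d.comp α₁ = α₀.comp pr.d)
    {e : M →ₗ[R] M} (he : pr.p.comp α₀ = e.comp pr.p) (hb : Bijective e)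
    {θ : CokerDual pr.d →ₗ[Rᵐᵒᵖ] CokerDual pr.d}
    (hθ : ∀ h, θ (cokerDualMk pr.d h) = cokerDualMk pr.d (h.comp α₁)) : Surjective θ := by
  intro t
  obtain ⟨k, rfl⟩ := cokerDualMk_surjective pr.d t
  let E := LinearEquiv.ofBijective α₁ (pr.bijective_of_comm h he hb).1
  refine ⟨cokerDualMk pr.d (k.comp E.symm.toLinearMap), ?_⟩
  rw [hθ]
  congr 1
  ext x
  exact congrArg k (E.symm_apply_apply x)

lemma MinPres.isIndec_cokerDual [IsArtinianRing R] (pr : MinPres R M) [Module.Finite R M]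
    (hM : IsIndec R M) (hproj : ¬ Module.Projective R M) : IsIndec Rᵐᵒᵖ (CokerDual pr.d) := by
  have : Nontrivial (CokerDual pr.d) := not_subsingleton_iff_nontrivial.1 fun _ =>
    hproj (projective_of_subsingleton_cokerDual pr.surj pr.exact)
  refine IsIndec.of_idempotent fun e _ => ?_
  obtain ⟨α₁, α₀, h, he⟩ := exists_lift_cokerDual pr.d pr.d e
  obtain ⟨ē, hē⟩ := exists_induced pr.surj pr.exact pr.exact h
  rcases hM.bijective_or ē with hb | hb
  · exact Or.inl (pr.surjective_of_comm h hē hb he)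
  · refine Or.inr (pr.surjective_of_comm (α₁ := LinearMap.id - α₁) (α₀ := LinearMap.id - α₀)
      ?_ (e := LinearMap.id - ē) ?_ hb fun k => ?_)
    · rw [LinearMap.comp_sub, LinearMap.sub_comp, h]; rfl
    · rw [LinearMap.comp_sub, LinearMap.sub_comp, hē]; rfl
    · rw [LinearMap.sub_apply, he, LinearMap.comp_sub, map_sub]; rfl

/-- Maps of presentations whose dual is a retraction induce isomorphisms. -/
lemma MinPres.bijective_of_retract [IsArtinianRing R] (pr : MinPres R M) [Module.Finite R M]
    (hM : IsIndec R M) (hproj : ¬ Module.Projective R M)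
    {α₁ : pr.P₁ →ₗ[R] pr.P₁} {α₀ : pr.P₀ →ₗ[R] pr.P₀} (h : pr.d.comp α₁ = α₀.comp pr.d)
    {e : M →ₗ[R] M} (he : pr.p.comp α₀ = e.comp pr.p)
    (hα : ∀ h, cokerDualMk pr.d (h.comp α₁) = cokerDualMk pr.d h) : Bijective e := by
  refine (hM.bijective_or e).resolve_right fun hb => hproj ?_
  have : Surjective (0 : CokerDual pr.d →ₗ[Rᵐᵒᵖ] CokerDual pr.d) := by
    refine pr.surjective_of_comm (α₁ := LinearMap.id - α₁) (α₀ := LinearMap.id - α₀)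
      ?_ (e := LinearMap.id - e) ?_ hb fun k => ?_
    · rw [LinearMap.comp_sub, LinearMap.sub_comp, h]; rfl
    · rw [LinearMap.comp_sub, LinearMap.sub_comp, he]; rfl
    · rw [LinearMap.comp_sub, map_sub, hα]
      exact (sub_self _).symm
  have : Subsingleton (CokerDual pr.d) :=
    subsingleton_of_forall_eq 0 fun t => by
      obtain ⟨s, rfl⟩ := this t
      rfl
  exact projective_of_subsingleton_cokerDual pr.surj pr.exact

lemma MinPres.nonempty_equiv_of_cokerDual [IsArtinianRing R] (pr : MinPres R M)
    [Module.Finite R M] (hM : IsIndec R M) (hproj : ¬ Module.Projective R M)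
    {N : Type u} [AddCommGroup N] [Module R N] (qr : MinPres R N)
    [Module.Finite R N] (hN : IsIndec R N)
    (E : CokerDual pr.d ≃ₗ[Rᵐᵒᵖ] CokerDual qr.d) : Nonempty (M ≃ₗ[R] N) := by
  obtain ⟨α₁, α₀, hα, hEα⟩ := exists_lift_cokerDual pr.d qr.d E.toLinearMap
  obtain ⟨β₁, β₀, hβ, hEβ⟩ := exists_lift_cokerDual qr.d pr.d E.symm.toLinearMap
  obtain ⟨a, ha⟩ := exists_induced qr.surj qr.exact pr.exact hα
  obtain ⟨b, hb⟩ := exists_induced pr.surj pr.exact qr.exact hβ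
  have hab : Bijective (a.comp b) := by
    refine pr.bijective_of_retract hM hproj (α₁ := α₁.comp β₁) (α₀ := α₀.comp β₀) ?_ ?_ fun h => ?_
    · rw [← LinearMap.comp_assoc, hα, LinearMap.comp_assoc, hβ, LinearMap.comp_assoc]
    · rw [← LinearMap.comp_assoc, ha, LinearMap.comp_assoc, hb, LinearMap.comp_assoc]
    · rw [← LinearMap.comp_assoc, ← hEβ, ← hEα]
      exact E.symm_apply_apply _
  have := hM.1
  let F := LinearEquiv.ofBijective (a.comp b) hab
  have hret : (F.symm.toLinearMap.comp a).comp b = LinearMap.id := by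
    ext x
    exact F.symm_apply_apply x
  exact ⟨LinearEquiv.ofBijective b (hN.bijective_of_retract hret)⟩

end Transpose

section TauRigid

variable {R : Type u} [Ring R] {M : Type u} [AddCommGroup M] [Module R M]

/-- Every map `P₁ → N` factors through `d : P₁ → P₀`. -/
def ExtendsAlong {P₁ P₀ : Type u} [AddCommGroup P₁] [Module R P₁] [AddCommGroup P₀] [Module R P₀]
    (d : P₁ →ₗ[R] P₀) (N : Type u) [AddCommGroup N] [Module R N] : Prop :=
  ∀ φ : P₁ →ₗ[R] N, ∃ g : P₀ →ₗ[R] N, g.comp d = φ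

lemma MinPres.hom_tau_eq_zero (K : Type u) [Field K] [Algebra K R] (pr : MinPres R M) {N : Type u}
    [AddCommGroup N] [Module R N] (h : ExtendsAlong pr.d N) (f : N →ₗ[R] pr.tau K) : f = 0 := by
  let β : N →+ (pr.P₁ →ₗ[R] R) →+ K :=
    AddMonoidHom.mk' (fun n => AddMonoidHom.mk' (fun k => OpDual.toL R K pr.Tr (f n) (pr.toTr k))
      (fun k l => map_add (OpDual.toL R K pr.Tr (f n)) (pr.toTr k) (pr.toTr l)))
      (fun n m => by
        ext k
        have : f (n + m) = f n + f m := map_add f n m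
        exact congrArg (fun z => OpDual.toL R K pr.Tr z (pr.toTr k)) this)
  have hsmul : ∀ (r : R) n k, β (r • n) k = β n (op r • k) := fun r n k => by
    have : f (r • n) = r • f n := map_smul f r n
    exact (congrArg (fun z => OpDual.toL R K pr.Tr z (pr.toTr k)) this)
  have hzero : ∀ n (g : pr.P₀ →ₗ[R] R), β n (g.comp pr.d) = 0 := fun n g => by
    have : pr.toTr (g.comp pr.d) = 0 :=
      (Submodule.Quotient.mk_eq_zero _).2 ⟨g, rfl⟩
    exact (congrArg (OpDual.toL R K pr.Tr (f n)) this).trans (map_zero _)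
  obtain ⟨n, e, ε, -, hε⟩ := exists_dualBasis R pr.P₁
  obtain ⟨m, a, δ, hδ, -⟩ := exists_dualBasis R pr.P₀
  have h1 : ∀ x k, ∑ i, β (k (e i) • x) (ε i) = β x k := fun x k => by
    conv_rhs => rw [← hε k]
    simp only [hsmul, map_sum]
  have h2 : ∀ g : pr.P₀ →ₗ[R] N, ∑ i, β (g (pr.d (e i))) (ε i) = 0 := fun g => by
    have : ∀ i, β (g (pr.d (e i))) (ε i) = ∑ j, β ((δ j).comp pr.d (e i) • g (a j)) (ε i) := by
      intro i
      conv_lhs => rw [← hδ (pr.d (e i))]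
      simp only [map_sum, map_smul, AddMonoidHom.finsetSum_apply, LinearMap.comp_apply]
    simp only [this]
    rw [Finset.sum_comm]
    refine Finset.sum_eq_zero fun j _ => ?_
    rw [h1, hzero]
  refine LinearMap.ext fun x => ?_
  refine OpDual.toL_injective R K pr.Tr (LinearMap.ext fun t => ?_)
  obtain ⟨k, rfl⟩ := Submodule.Quotient.mk_surjective _ t
  obtain ⟨g, hg⟩ := h (k.smulRight x)
  have h3 : β x k = 0 := by
    rw [← h1, ← h2 g]
    refine Finset.sum_congr rfl fun i _ => ?_
    have := LinearMap.congr_fun hg (e i)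
    rw [LinearMap.comp_apply] at this
    rw [this]; rfl
  exact h3

lemma MinPres.extendsAlong_of_hom_tau_eq_zero (K : Type u) [Field K] [Algebra K R]
    (pr : MinPres R M) {N : Type u} [AddCommGroup N] [Module R N]
    (h : ∀ f : N →ₗ[R] pr.tau K, f = 0) : ExtendsAlong pr.d N := by
  let : Module K N := Module.compHom N (algebraMap K R)
  have : IsScalarTower K R N := IsScalarTower.of_algebraMap_smul fun _ _ => rfl
  intro φ
  let W : Submodule K (pr.P₁ →ₗ[R] N) :=
    { carrier := {φ | ∃ g : pr.P₀ →ₗ[R] N, g.comp pr.d = φ}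
      add_mem' := by
        rintro _ _ ⟨g, rfl⟩ ⟨g', rfl⟩
        exact ⟨g + g', rfl⟩
      zero_mem' := ⟨0, rfl⟩
      smul_mem' := by
        rintro c _ ⟨g, rfl⟩
        exact ⟨c • g, rfl⟩ }
  by_contra hφ
  obtain ⟨l, hl, hW⟩ := Submodule.exists_le_ker_of_notMem (p := W) (v := φ) hφ
  let F : N → pr.Tr →+ K := fun x =>
    QuotientAddGroup.lift (LinearMap.range pr.dualMap).toAddSubgroup
      (AddMonoidHom.mk' (fun k : pr.P₁ →ₗ[R] R => l (k.smulRight x)) (fun k k' => by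
        rw [← map_add]
        congr 1
        ext y
        simp [add_smul]))
      (by
        rintro _ ⟨g, rfl⟩
        exact hW ⟨g.smulRight x, rfl⟩)
  have hF : ∀ x k, F x (pr.toTr k) = l (k.smulRight x) := fun x k => rfl
  let f : N →ₗ[R] pr.tau K :=
    { toFun := fun x => ({ F x with
        map_smul' := fun c t => by
          obtain ⟨k, rfl⟩ := Submodule.Quotient.mk_surjective _ t
          change l ((c • k).smulRight x) = c • l (k.smulRight x)
          rw [← map_smul]
          congr 1
          ext y
          simp [smul_assoc] } : pr.Tr →ₗ[K] K)
      map_add' := fun x y => by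
        refine OpDual.toL_injective R K pr.Tr (LinearMap.ext fun t => ?_)
        obtain ⟨k, rfl⟩ := Submodule.Quotient.mk_surjective _ t
        change l (k.smulRight (x + y)) = l (k.smulRight x) + l (k.smulRight y)
        rw [← map_add]
        congr 1
        ext y
        simp
      map_smul' := fun r x => by
        refine OpDual.toL_injective R K pr.Tr (LinearMap.ext fun t => ?_)
        obtain ⟨k, rfl⟩ := Submodule.Quotient.mk_surjective _ t
        change l (k.smulRight (r • x)) = l ((op r • k).smulRight x)
        congr 1
        ext y
        simp [mul_smul] }
  have hf : ∀ (x : N) (k : pr.P₁ →ₗ[R] R), l (k.smulRight x) = 0 := fun x k => by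
    have h1 : f x = 0 := by rw [h f]; rfl
    exact congrArg (fun z => OpDual.toL R K pr.Tr z (pr.toTr k)) h1
  obtain ⟨n, e, ε, hε, -⟩ := exists_dualBasis R pr.P₁
  apply hl
  have : φ = ∑ i, (ε i).smulRight (φ (e i)) := by
    ext x
    conv_lhs => rw [← hε x]
    simp
  rw [this, map_sum]
  exact Finset.sum_eq_zero fun i _ => hf _ _

lemma isTauRigid_iff (K : Type u) [Field K] [Algebra K R] :
    IsTauRigid R K M ↔ ∀ pr : MinPres R M, ExtendsAlong pr.d M :=
  ⟨fun h pr => pr.extendsAlong_of_hom_tau_eq_zero K (h pr),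
    fun h pr => pr.hom_tau_eq_zero K (h pr)⟩

lemma extendsAlong_dualHom {P₁ P₀ : Type u} [AddCommGroup P₁] [Module R P₁]
    [AddCommGroup P₀] [Module R P₀] [Module.Projective R P₁]
    [Module.Finite R P₀] [Module.Projective R P₀] {d : P₁ →ₗ[R] P₀} {p : P₀ →ₗ[R] M}
    (hp : Surjective p) (hd : Exact d p) (h : ExtendsAlong d M) :
    ExtendsAlong (dualHom d) (CokerDual d) := by
  intro ψ
  obtain ⟨n, e, ε, -, hε⟩ := exists_dualBasis R P₀
  choose k hk using fun j => cokerDualMk_surjective d (ψ (ε j))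
  have hs : ∀ j, ∃ (s : P₁ →ₗ[R] P₁) (g : P₀ →ₗ[R] P₀),
      ∀ y, k j y • e j = g (d y) + d (s y) := by
    intro j
    obtain ⟨g, hg⟩ := h ((k j).smulRight (p (e j)))
    obtain ⟨g', rfl⟩ := Module.projective_lifting_property p g hp
    have hmem : ∀ y, ((k j).smulRight (e j) - g'.comp d) y ∈ LinearMap.range d := fun y => by
      apply (hd _).1
      have := LinearMap.congr_fun hg y
      simp only [LinearMap.comp_apply, LinearMap.smulRight_apply] at this
      simp [this]
    obtain ⟨s, hs⟩ := Module.projective_lifting_property d.rangeRestrict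
      (((k j).smulRight (e j) - g'.comp d).codRestrict _ hmem)
      (LinearMap.surjective_rangeRestrict _)
    refine ⟨s, g', fun y => ?_⟩
    have h1 : d (s y) = k j y • e j - g' (d y) := congrArg Subtype.val (LinearMap.congr_fun hs y)
    rw [h1]; abel
  choose s g hsg using hs
  refine ⟨∑ j, (cokerDualMk d).comp (dualHom (s j)), LinearMap.ext fun l => ?_⟩
  conv_rhs => rw [← hε l]
  rw [LinearMap.comp_apply, LinearMap.sum_apply, map_sum]
  refine Finset.sum_congr rfl fun j _ => ?_
  rw [map_smul, ← hk, ← map_smul, eq_comm, ← sub_eq_zero, LinearMap.comp_apply, ← map_sub,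
    cokerDualMk_eq_zero_iff]
  refine ⟨l.comp (g j), LinearMap.ext fun y => ?_⟩
  have := congrArg l (hsg j y)
  simp only [map_smul, map_add, smul_eq_mul] at this
  simp [dualHom_apply, this]

lemma MinPres.extendsAlong_of_presentation [IsArtinianRing R] (pr : MinPres R M) {Q₁ Q₀ : Type u}
    [AddCommGroup Q₁] [Module R Q₁] [AddCommGroup Q₀] [Module R Q₀] [Module.Projective R Q₁]
    [Module.Projective R Q₀] {d : Q₁ →ₗ[R] Q₀} {p : Q₀ →ₗ[R] M} (hp : Surjective p)
    (hd : Exact d p) {N : Type u} [AddCommGroup N] [Module R N] (h : ExtendsAlong d N) :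
    ExtendsAlong pr.d N := by
  intro φ
  obtain ⟨u₁, u₀, v₁, v₀, hu, hv, hb, -⟩ := pr.exists_retract hp hd
  let E := LinearEquiv.ofBijective _ hb
  obtain ⟨g, hg⟩ := h ((φ.comp E.symm.toLinearMap).comp v₁)
  refine ⟨g.comp u₀, ?_⟩
  rw [LinearMap.comp_assoc, ← hu, ← LinearMap.comp_assoc, hg]
  ext x
  exact congrArg φ (E.symm_apply_apply x)

lemma IsTauRigid.cokerDual (K : Type u) [Field K] [Algebra K R] [IsArtinianRing Rᵐᵒᵖ]
    (hM : IsTauRigid R K M) (pr : MinPres R M) : IsTauRigid Rᵐᵒᵖ K (CokerDual pr.d) :=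
  (isTauRigid_iff K).2 fun qr => qr.extendsAlong_of_presentation (cokerDualMk_surjective _)
    (exact_dualHom_cokerDualMk _)
    (extendsAlong_dualHom pr.surj pr.exact ((isTauRigid_iff K).1 hM pr))

lemma IsTauRigid.of_projective (K : Type u) [Field K] [Algebra K R] [IsArtinianRing R]
    [Module.Projective R M] : IsTauRigid R K M :=
  (isTauRigid_iff K).2 fun qr => qr.extendsAlong_of_presentation (Q₁ := PUnit) (Q₀ := M)
    (d := 0) (p := LinearMap.id) surjective_id
    (fun x => ⟨fun h => ⟨0, h.symm⟩, by rintro ⟨y, rfl⟩; rfl⟩)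
    (fun φ => ⟨0, LinearMap.ext fun x => by
      rw [Subsingleton.elim x 0, map_zero, map_zero]⟩)

end TauRigid

section ExtVanish

open CategoryTheory CategoryTheory.Abelian

variable (R : Type u) [Ring R]

/-- `Extⁿ(X, R) = 0` for all `n ≥ 1`. -/
def ExtVanish (X : Type u) [AddCommGroup X] [Module R X] : Prop :=
  ∀ (n : ℕ) (x : Ext (ModuleCat.of R X) (ModuleCat.of R R) (n + 1)), x = 0

variable {R}
variable {X Y Z : Type u} [AddCommGroup X] [Module R X] [AddCommGroup Y] [Module R Y]
  [AddCommGroup Z] [Module R Z]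

lemma ExtVanish.of_retract (hY : ExtVanish R Y) (i : X →ₗ[R] Y) (p : Y →ₗ[R] X)
    (hpi : p.comp i = LinearMap.id) : ExtVanish R X := by
  intro n x
  have h := congrArg (fun e => (Ext.mk₀ (ModuleCat.ofHom i)).comp e (zero_add _))
    (hY n ((Ext.mk₀ (ModuleCat.ofHom p)).comp x (zero_add _)))
  simp only [Ext.mk₀_comp_mk₀_assoc, ← ModuleCat.ofHom_comp, hpi, ModuleCat.ofHom_id,
    Ext.mk₀_id_comp, Ext.comp_zero] at h
  exact h

lemma ExtVanish.of_equiv (hY : ExtVanish R Y) (e : X ≃ₗ[R] Y) : ExtVanish R X :=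
  hY.of_retract e.toLinearMap e.symm.toLinearMap (LinearMap.ext fun x => e.symm_apply_apply x)

lemma ExtVanish.of_projective [Module.Projective R X] : ExtVanish R X := by
  intro n x
  have : Projective (ModuleCat.of R X) :=
    (IsProjective.iff_projective (R := R) X).1 inferInstance
  exact Ext.eq_zero_of_projective x

variable {i : X →ₗ[R] Y} {p : Y →ₗ[R] Z} (hi : Injective i) (hip : Exact i p)
  (hp : Surjective p)

include hi hip hp

lemma shortExact_of_exact :
    (ShortComplex.mk (ModuleCat.ofHom i) (ModuleCat.ofHom p)
      (by ext x; exact hip.apply_apply_eq_zero x)).ShortExact :=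
  { exact := (CategoryTheory.ShortComplex.ShortExact.moduleCat_exact_iff_function_exact _).2 hip
    mono_f := (ModuleCat.mono_iff_injective _).2 hi
    epi_g := (ModuleCat.epi_iff_surjective _).2 hp }

lemma ext_succ_eq_zero_of_exact [Module.Projective R Y] {n : ℕ}
    (h : ∀ x : Ext (ModuleCat.of R X) (ModuleCat.of R R) (n + 1), x = 0)
    (x : Ext (ModuleCat.of R Z) (ModuleCat.of R R) (n + 1 + 1)) : x = 0 := by
  have : Projective (ModuleCat.of R Y) :=
    (IsProjective.iff_projective (R := R) Y).1 inferInstance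
  obtain ⟨y, rfl⟩ := Ext.contravariant_sequence_exact₃ (shortExact_of_exact hi hip hp)
    (ModuleCat.of R R) x (Ext.eq_zero_of_projective _) (add_comm 1 (n + 1))
  rw [h y, Ext.comp_zero]

lemma ext_one_eq_zero_of_exact [Module.Projective R Y]
    (h : ∀ f : X →ₗ[R] R, ∃ g : Y →ₗ[R] R, g.comp i = f)
    (x : Ext (ModuleCat.of R Z) (ModuleCat.of R R) 1) : x = 0 := by
  have : Projective (ModuleCat.of R Y) :=
    (IsProjective.iff_projective (R := R) Y).1 inferInstance
  obtain ⟨y, rfl⟩ := Ext.contravariant_sequence_exact₃ (shortExact_of_exact hi hip hp)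
    (ModuleCat.of R R) x (Ext.eq_zero_of_projective _) (add_zero 1)
  obtain ⟨f, rfl⟩ := (Ext.mk₀_bijective _ _).2 y
  obtain ⟨g, hg⟩ := h f.hom
  have hf : f = ModuleCat.ofHom i ≫ ModuleCat.ofHom g := ModuleCat.hom_ext hg.symm
  rw [hf, ← Ext.mk₀_comp_mk₀]
  exact ShortComplex.ShortExact.extClass_comp_assoc _ _

lemma ExtVanish.exists_extension (hZ : ExtVanish R Z) (f : X →ₗ[R] R) :
    ∃ g : Y →ₗ[R] R, g.comp i = f := by
  obtain ⟨y, hy⟩ := Ext.contravariant_sequence_exact₁ (shortExact_of_exact hi hip hp)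
    (ModuleCat.of R R) (Ext.mk₀ (ModuleCat.ofHom f)) (n₁ := 1) (add_zero 1) (hZ 0 _)
  obtain ⟨g, rfl⟩ := (Ext.mk₀_bijective _ _).2 y
  refine ⟨g.hom, ?_⟩
  rw [Ext.mk₀_comp_mk₀] at hy
  have := (Ext.mk₀_bijective _ _).1 hy
  exact congrArg ModuleCat.Hom.hom this

lemma ExtVanish.kernel [Module.Projective R Y] (hZ : ExtVanish R Z) : ExtVanish R X := by
  intro n x
  have : Projective (ModuleCat.of R Y) :=
    (IsProjective.iff_projective (R := R) Y).1 inferInstance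
  obtain ⟨y, rfl⟩ := Ext.contravariant_sequence_exact₁ (shortExact_of_exact hi hip hp)
    (ModuleCat.of R R) x (add_comm 1 (n + 1)) (hZ _ _)
  rw [Ext.eq_zero_of_projective y, Ext.comp_zero]

end ExtVanish

section GorensteinProjective

variable {R : Type u} [Ring R]

lemma exists_int_seq {σ : Type*} {rel : σ → σ → Prop} {𝓛 𝓡 : σ → Prop}
    (hl : ∀ s, 𝓛 s → ∃ t, 𝓛 t ∧ rel t s) (hr : ∀ s, 𝓡 s → ∃ t, 𝓡 t ∧ rel s t) {s : σ}
    (hsl : 𝓛 s) (hsr : 𝓡 s) : ∃ x : ℤ → σ, x 0 = s ∧ ∀ n, rel (x n) (x (n + 1)) := by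
  choose l hl₁ hl₂ using hl
  choose r hr₁ hr₂ using hr
  let a : ℕ → {s // 𝓛 s} := Nat.rec ⟨s, hsl⟩ fun _ t => ⟨l t.1 t.2, hl₁ t.1 t.2⟩
  let b : ℕ → {s // 𝓡 s} := Nat.rec ⟨s, hsr⟩ fun _ t => ⟨r t.1 t.2, hr₁ t.1 t.2⟩
  let x : ℤ → σ := fun n => match n with
    | Int.ofNat n => (b n).1
    | Int.negSucc n => (a (n + 1)).1
  refine ⟨x, rfl, fun n => ?_⟩
  match n with
  | Int.ofNat n => exact hr₂ (b n).1 (b n).2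
  | Int.negSucc 0 => exact hl₂ s hsl
  | Int.negSucc (n + 1) => exact hl₂ (a (n + 1)).1 (a (n + 1)).2

/-- There is an exact sequence `0 → A → P → B → 0` with `P` finitely generated projective,
which stays exact under `Hom(-, R)`. -/
def HomExactStep (A B : ModuleCat.{u} R) : Prop :=
  ∃ (P : Type u) (_ : AddCommGroup P) (_ : Module R P) (i : A →ₗ[R] P) (p : P →ₗ[R] B),
    Module.Finite R P ∧ Module.Projective R P ∧ Injective i ∧ Exact i p ∧ Surjective p ∧
    ∀ f : A →ₗ[R] R, ∃ g : P →ₗ[R] R, g.comp i = f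

lemma isGP_of_homExactStep {M : Type u} [AddCommGroup M] [Module R M] (x : ℤ → ModuleCat.{u} R)
    (hx : ∀ n, HomExactStep (x n) (x (n + 1))) (e : M ≃ₗ[R] x 0) : IsGP R M := by
  choose P h₁ h₂ i p hfin hproj hi hip hp hext using hx
  refine ⟨P, h₁, h₂, fun n => (i (n + 1)).comp (p n), hfin, hproj, fun n y => ?_,
    fun n f => ?_, ⟨?_⟩⟩
  · have h3 : ((i (n + 1 + 1)).comp (p (n + 1))) y = 0 ↔ p (n + 1) y = 0 := by
      rw [LinearMap.comp_apply, ← map_zero (i (n + 1 + 1)), (hi (n + 1 + 1)).eq_iff]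
    rw [h3, hip (n + 1) y]
    constructor
    · rintro ⟨z, rfl⟩
      obtain ⟨w, rfl⟩ := hp n z
      exact ⟨w, rfl⟩
    · rintro ⟨w, rfl⟩
      exact ⟨p n w, rfl⟩
  · constructor
    · intro hf
      obtain ⟨f', rfl⟩ := exists_descent (hp (n + 1)) f (by
        intro y hy
        obtain ⟨z, rfl⟩ := (hip (n + 1) y).1 hy
        obtain ⟨w, rfl⟩ := hp n z
        exact LinearMap.congr_fun hf w)
      obtain ⟨g, rfl⟩ := hext (n + 1 + 1) f'
      exact ⟨g, rfl⟩
    · rintro ⟨g, rfl⟩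
      ext y
      change g (i (n + 1 + 1) (p (n + 1) (i (n + 1) (p n y)))) = 0
      rw [(hip (n + 1)).apply_apply_eq_zero, map_zero, map_zero]
  · refine (e.trans (LinearEquiv.ofInjective (i (-1 + 1)) (hi (-1 + 1)))).trans
      (LinearEquiv.ofEq _ _ ?_)
    rw [LinearMap.range_comp_of_range_eq_top _ (LinearMap.range_eq_top.2 (hp (-1)))]

lemma IsGP.exists_homExactStep {M : Type u} [AddCommGroup M] [Module R M] (h : IsGP R M) :
    ∃ x : ℤ → ModuleCat.{u} R, (∀ n, HomExactStep (x n) (x (n + 1))) ∧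
      Nonempty (M ≃ₗ[R] x 0) := by
  obtain ⟨P, h₁, h₂, d, hfin, hproj, hd, hd', ⟨e⟩⟩ := h
  refine ⟨fun n => ModuleCat.of R (LinearMap.ker (d n)), fun n => ?_, ⟨e.trans
    (LinearEquiv.ofEq _ (LinearMap.ker (d (-1 + 1))) (hd (-1)).linearMap_ker_eq.symm)⟩⟩
  refine ⟨P n, h₁ n, h₂ n, (LinearMap.ker (d n)).subtype,
    (d n).codRestrict (LinearMap.ker (d (n + 1))) fun y => (hd n).apply_apply_eq_zero y,
    hfin n, hproj n, Subtype.coe_injective, fun y => ?_, fun y => ?_, ?_⟩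
  · rw [← Subtype.coe_inj]
    exact ⟨fun hy => ⟨⟨y, hy⟩, rfl⟩, by rintro ⟨z, rfl⟩; exact z.2⟩
  · obtain ⟨z, hz⟩ := (hd n y.1).1 y.2
    exact ⟨z, Subtype.ext hz⟩
  · obtain ⟨m, rfl⟩ : ∃ m, n = m + 1 + 1 := ⟨n - 2, by ring⟩
    intro f
    let q := (d (m + 1)).codRestrict (LinearMap.ker (d (m + 1 + 1)))
      fun y => (hd (m + 1)).apply_apply_eq_zero y
    obtain ⟨g, hg⟩ := (hd' m (f.comp q)).1 (by
      ext y
      have : q (d m y) = 0 := Subtype.ext ((hd m).apply_apply_eq_zero y)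
      change f (q (d m y)) = 0
      rw [this, map_zero])
    refine ⟨g, LinearMap.ext fun y => ?_⟩
    obtain ⟨z, hz⟩ := (hd (m + 1) y.1).1 y.2
    have hzy : q z = y := Subtype.ext hz
    rw [← hzy]
    exact LinearMap.congr_fun hg z

lemma extVanish_of_homExactStep {x : ℤ → ModuleCat.{u} R}
    (hx : ∀ n, HomExactStep (x n) (x (n + 1))) (n : ℤ) : ExtVanish R (x n) := by
  intro k
  induction k generalizing n with
  | zero =>
    obtain ⟨m, rfl⟩ : ∃ m, n = m + 1 := ⟨n - 1, by ring⟩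
    obtain ⟨P, _, _, i, p, _, _, hi, hip, hp, h⟩ := hx m
    exact ext_one_eq_zero_of_exact hi hip hp h
  | succ k ih =>
    obtain ⟨m, rfl⟩ : ∃ m, n = m + 1 := ⟨n - 1, by ring⟩
    obtain ⟨P, _, _, i, p, _, _, hi, hip, hp, h⟩ := hx m
    exact ext_succ_eq_zero_of_exact hi hip hp (ih m)

lemma HomExactStep.dual {A B C D : ModuleCat.{u} R} (h₁ : HomExactStep A B)
    (h₂ : HomExactStep B C) (h₃ : HomExactStep C D) :
    HomExactStep (ModuleCat.of Rᵐᵒᵖ (B →ₗ[R] R)) (ModuleCat.of Rᵐᵒᵖ (A →ₗ[R] R)) := by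
  obtain ⟨P, _, _, i, p, _, _, hi, hip, hp, h⟩ := h₁
  obtain ⟨P', _, _, i', p', _, _, hi', hip', hp', h'⟩ := h₂
  obtain ⟨P'', _, _, i'', p'', _, _, hi'', -, -, -⟩ := h₃
  refine ⟨P →ₗ[R] R, inferInstance, inferInstance, dualHom p, dualHom i, inferInstance,
    inferInstance, fun f g hfg => ?_, fun f => ?_, h, fun φ => ?_⟩
  · exact LinearMap.cancel_right hp |>.1 hfg
  · constructor
    · intro hf
      exact exists_descent hp f fun y hy => by
        obtain ⟨z, rfl⟩ := (hip y).1 hy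
        exact LinearMap.congr_fun hf z
    · rintro ⟨g, rfl⟩
      ext y
      change g (p (i y)) = 0
      rw [hip.apply_apply_eq_zero, map_zero]
  · obtain ⟨y, hy⟩ := exists_eval (φ.comp (dualHom i'))
    have hy' : p' y = 0 := by
      apply hi''
      rw [map_zero]
      refine eq_zero_of_forall_dual (R := R) fun f => ?_
      have h4 := hy ((f.comp i'').comp p')
      have h5 : dualHom i' ((f.comp i'').comp p') = 0 := by
        ext z
        change f (i'' (p' (i' z))) = 0
        rw [hip'.apply_apply_eq_zero, map_zero, map_zero]
      rw [LinearMap.comp_apply, h5, map_zero] at h4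
      exact (op_injective h4.symm)
    obtain ⟨z, rfl⟩ := (hip' y).1 hy'
    obtain ⟨w, rfl⟩ := hp z
    refine ⟨{ toFun := fun f => op (f w), map_add' := fun _ _ => rfl,
              map_smul' := fun _ _ => rfl }, LinearMap.ext fun f => ?_⟩
    obtain ⟨g, rfl⟩ := h' f
    exact (hy g).symm

lemma IsGP.extVanish {M : Type u} [AddCommGroup M] [Module R M] (h : IsGP R M) :
    ExtVanish R M := by
  obtain ⟨x, hx, ⟨e⟩⟩ := h.exists_homExactStep
  exact (extVanish_of_homExactStep hx 0).of_equiv e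

lemma extVanish_dual_of_homExactStep {x : ℤ → ModuleCat.{u} R}
    (hx : ∀ n, HomExactStep (x n) (x (n + 1))) (n : ℤ) : ExtVanish Rᵐᵒᵖ (x n →ₗ[R] R) := by
  have h := extVanish_of_homExactStep (R := Rᵐᵒᵖ)
    (x := fun n => ModuleCat.of Rᵐᵒᵖ (x (-n) →ₗ[R] R)) (fun n => by
      have h1 := (hx (-(n + 1))).dual (hx _) (hx _)
      have h2 : -(n + 1) + 1 = -n := by ring
      rw [h2] at h1
      exact h1) (-n)
  change ExtVanish Rᵐᵒᵖ (x (- -n) →ₗ[R] R) at h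
  rwa [neg_neg] at h

section Presentation

variable {P₁ P₀ Q₁ Q₀ : Type u} [AddCommGroup P₁] [Module R P₁]
    [AddCommGroup P₀] [Module R P₀] [AddCommGroup Q₁] [Module R Q₁] [AddCommGroup Q₀] [Module R Q₀]

lemma ExtVanish.cokerDual_of_retract [IsNoetherianRing Rᵐᵒᵖ] [Module.Finite R Q₁]
    [Module.Projective R Q₁]
    {d : P₁ →ₗ[R] P₀} {d' : Q₁ →ₗ[R] Q₀} (hd : ExtVanish Rᵐᵒᵖ (CokerDual d))
    {u₁ : Q₁ →ₗ[R] P₁} {u₀ : Q₀ →ₗ[R] P₀} {v₁ : P₁ →ₗ[R] Q₁} {v₀ : P₀ →ₗ[R] Q₀}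
    (hu : d.comp u₁ = u₀.comp d') (hv : d'.comp v₁ = v₀.comp d)
    (huv : Bijective (v₁.comp u₁)) : ExtVanish Rᵐᵒᵖ (CokerDual d') := by
  let e := LinearEquiv.ofBijective _ huv
  let U : CokerDual d →ₗ[Rᵐᵒᵖ] CokerDual d' := Submodule.mapQ _ _ (dualHom u₁) (by
    rintro _ ⟨g, rfl⟩
    exact ⟨g.comp u₀, by simp only [dualHom_apply, LinearMap.comp_assoc, hu]⟩)
  let V : CokerDual d' →ₗ[Rᵐᵒᵖ] CokerDual d := Submodule.mapQ _ _ (dualHom v₁) (by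
    rintro _ ⟨g, rfl⟩
    exact ⟨g.comp v₀, by simp only [dualHom_apply, LinearMap.comp_assoc, hv]⟩)
  have hs : Surjective (U.comp V) := by
    intro y
    obtain ⟨h, rfl⟩ := cokerDualMk_surjective d' y
    refine ⟨cokerDualMk d' (h.comp e.symm.toLinearMap), ?_⟩
    change cokerDualMk d' (((h.comp e.symm.toLinearMap).comp v₁).comp u₁) = _
    congr 1
    ext z
    exact congrArg h (e.symm_apply_apply z)
  let w := LinearEquiv.ofBijective _
    ⟨IsNoetherian.injective_of_surjective_endomorphism _ hs, hs⟩
  exact hd.of_retract (V.comp w.symm.toLinearMap) U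
    (LinearMap.ext fun y => w.apply_symm_apply y)

lemma IsGP.extVanish_cokerDual [IsArtinianRing R] [IsNoetherianRing Rᵐᵒᵖ] {M : Type u}
    [AddCommGroup M] [Module R M] (h : IsGP R M) (pr : MinPres R M) :
    ExtVanish Rᵐᵒᵖ (CokerDual pr.d) := by
  obtain ⟨x, hx, ⟨e⟩⟩ := h.exists_homExactStep
  obtain ⟨P, _, _, i, p, _, _, hi, hip, hp, he⟩ := hx (-2)
  obtain ⟨P', _, _, i', p', _, _, hi', hip', hp', he'⟩ := hx (-2 + 1)
  let e' : x (-2 + 1 + 1) ≃ₗ[R] M := e.symm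
  have hd : Exact (i'.comp p) (e'.toLinearMap.comp p') := by
    intro y
    rw [LinearMap.comp_apply, LinearEquiv.coe_coe, e'.map_eq_zero_iff, hip' y]
    constructor
    · rintro ⟨z, rfl⟩
      obtain ⟨w, rfl⟩ := hp z
      exact ⟨w, rfl⟩
    · rintro ⟨w, rfl⟩
      exact ⟨p w, rfl⟩
  obtain ⟨u₁, u₀, v₁, v₀, hu, hv, huv, -⟩ := pr.exists_retract
    (p := e'.toLinearMap.comp p') (e'.surjective.comp hp') hd
  refine ExtVanish.cokerDual_of_retract (d := i'.comp p) ?_ hu hv huv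
  have hk : LinearMap.range (dualHom (i'.comp p)) = LinearMap.ker (dualHom i) := by
    ext f
    constructor
    · rintro ⟨g, rfl⟩
      ext y
      change g (i' (p (i y))) = 0
      rw [hip.apply_apply_eq_zero, map_zero, map_zero]
    · intro hf
      obtain ⟨f', rfl⟩ := exists_descent hp f (by
        intro y hy
        obtain ⟨z, rfl⟩ := (hip y).1 hy
        exact LinearMap.congr_fun hf z)
      obtain ⟨g, rfl⟩ := he' f'
      exact ⟨g, rfl⟩
  exact (extVanish_dual_of_homExactStep hx (-2)).of_equiv
    ((Submodule.quotEquivOfEq _ _ hk).trans ((dualHom i).quotKerEquivOfSurjective he))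

lemma exists_homExactStep_of_extVanish [IsNoetherianRing R] {X : Type u} [AddCommGroup X]
    [Module R X] [Module.Finite R X] (hX : ExtVanish R X) :
    ∃ Y : ModuleCat.{u} R, (Module.Finite R Y ∧ ExtVanish R Y) ∧
      HomExactStep Y (ModuleCat.of R X) := by
  obtain ⟨n, p, hp⟩ := Module.Finite.exists_fin' R X
  have hk : Exact (LinearMap.ker p).subtype p := LinearMap.exact_subtype_ker_map p
  refine ⟨ModuleCat.of R (LinearMap.ker p),
    ⟨(inferInstance : Module.Finite R (LinearMap.ker p)),
      hX.kernel (Submodule.injective_subtype _) hk hp⟩, _, inferInstance, inferInstance,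
    (LinearMap.ker p).subtype, p, inferInstance, inferInstance, Submodule.injective_subtype _,
    hk, hp, hX.exists_extension (Submodule.injective_subtype _) hk hp⟩

/-- A homomorphism `P₁ → P₀` between finitely generated projective modules whose cokernel has
vanishing extensions by the ring. -/
structure IsExtPresentation (d : P₁ →ₗ[R] P₀) : Prop where
  fin₁ : Module.Finite R P₁
  proj₁ : Module.Projective R P₁
  fin₀ : Module.Finite R P₀
  proj₀ : Module.Projective R P₀
  ext : ExtVanish R (P₀ ⧸ LinearMap.range d)

lemma IsExtPresentation.exists_homExactStep [IsNoetherianRing R] {d : P₁ →ₗ[R] P₀}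
    (hd : IsExtPresentation d) : ∃ (n : ℕ) (d' : (Fin n → R) →ₗ[R] P₁), IsExtPresentation d' ∧
      HomExactStep (ModuleCat.of Rᵐᵒᵖ (CokerDual d)) (ModuleCat.of Rᵐᵒᵖ (CokerDual d')) := by
  obtain ⟨h1, h2, h3, h4, hE⟩ := hd
  obtain ⟨n, q, hq⟩ := Module.Finite.exists_fin' R (LinearMap.ker d)
  let d' := (LinearMap.ker d).subtype.comp q
  have hd' : LinearMap.range d' = LinearMap.ker d := by
    rw [LinearMap.range_comp_of_range_eq_top _ (LinearMap.range_eq_top.2 hq),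
      Submodule.range_subtype]
  have hdd' : ∀ x, d (d' x) = 0 := fun x => (q x).2
  have hk : Exact (LinearMap.range d).subtype (LinearMap.range d).mkQ :=
    LinearMap.exact_subtype_mkQ _
  have hext : ∀ f : P₁ →ₗ[R] R, f.comp d' = 0 → ∃ g : P₀ →ₗ[R] R, g.comp d = f := by
    intro f hf
    obtain ⟨f', rfl⟩ := exists_descent d.surjective_rangeRestrict f (by
      intro y hy
      have : y ∈ LinearMap.range d' := by rw [hd']; exact congrArg Subtype.val hy
      obtain ⟨z, rfl⟩ := this
      exact LinearMap.congr_fun hf z)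
    obtain ⟨g, rfl⟩ := hE.exists_extension (Submodule.injective_subtype _) hk
      (Submodule.mkQ_surjective _) f'
    exact ⟨g, rfl⟩
  let i : CokerDual d →ₗ[Rᵐᵒᵖ] ((Fin n → R) →ₗ[R] R) :=
    (LinearMap.range (dualHom d)).liftQ (dualHom d') (by
      rintro _ ⟨g, rfl⟩
      ext y
      change g (d (d' _)) = 0
      rw [hdd', map_zero])
  have hi : ∀ f, i (cokerDualMk d f) = dualHom d' f := fun f => rfl
  refine ⟨n, d', ⟨inferInstance, inferInstance, h1, h2, ?_⟩, _, inferInstance, inferInstance,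
    i, cokerDualMk d', inferInstance, inferInstance, ?_, fun f => ?_,
    cokerDualMk_surjective d', fun φ => ?_⟩
  · exact (hE.kernel (Submodule.injective_subtype _) hk (Submodule.mkQ_surjective _)).of_equiv
      ((Submodule.quotEquivOfEq _ _ hd').trans d.quotKerEquivRange)
  · refine (injective_iff_map_eq_zero i).2 fun y hy => ?_
    obtain ⟨f, rfl⟩ := cokerDualMk_surjective d y
    exact (cokerDualMk_eq_zero_iff d f).2 (hext f hy)
  · rw [cokerDualMk_eq_zero_iff]
    constructor
    · rintro ⟨g, rfl⟩
      exact ⟨cokerDualMk d g, rfl⟩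
    · rintro ⟨y, rfl⟩
      obtain ⟨g, rfl⟩ := cokerDualMk_surjective d y
      exact ⟨g, rfl⟩
  · obtain ⟨y, hy⟩ := exists_eval (φ.comp (cokerDualMk d))
    have hy' : d y = 0 := eq_zero_of_forall_dual (R := R) fun f => by
      have h5 := hy (f.comp d)
      rw [LinearMap.comp_apply, (cokerDualMk_eq_zero_iff d _).2 ⟨f, rfl⟩] at h5
      rw [map_zero] at h5
      exact op_injective h5.symm
    have hy'' : y ∈ LinearMap.range d' := by rw [hd']; exact hy'
    obtain ⟨z, rfl⟩ := hy''
    refine ⟨{ toFun := fun f => op (f z), map_add' := fun _ _ => rfl,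
              map_smul' := fun _ _ => rfl }, LinearMap.ext fun t => ?_⟩
    obtain ⟨g, rfl⟩ := cokerDualMk_surjective d t
    exact (hy g).symm

lemma isGP_cokerDual [IsNoetherianRing R] [IsNoetherianRing Rᵐᵒᵖ] {d : P₁ →ₗ[R] P₀}
    (hd : IsExtPresentation d) (hE : ExtVanish Rᵐᵒᵖ (CokerDual d)) :
    IsGP Rᵐᵒᵖ (CokerDual d) := by
  have := hd.fin₁
  have := hd.proj₁
  obtain ⟨x, hx0, hx⟩ := exists_int_seq (σ := ModuleCat.{u} Rᵐᵒᵖ) (rel := HomExactStep)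
    (𝓛 := fun X => Module.Finite Rᵐᵒᵖ X ∧ ExtVanish Rᵐᵒᵖ X)
    (𝓡 := fun X => ∃ (P Q : Type u) (_ : AddCommGroup P) (_ : Module R P) (_ : AddCommGroup Q)
      (_ : Module R Q) (f : P →ₗ[R] Q), IsExtPresentation f ∧ X = ModuleCat.of _ (CokerDual f))
    (fun X ⟨_, h⟩ => exists_homExactStep_of_extVanish h)
    (fun X => by
      rintro ⟨P, Q, _, _, _, _, f, hf, rfl⟩
      obtain ⟨n, f', hf', h⟩ := hf.exists_homExactStep
      exact ⟨_, ⟨_, _, _, _, _, _, f', hf', rfl⟩, h⟩)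
    (s := ModuleCat.of _ (CokerDual d))
    ⟨(inferInstance : Module.Finite Rᵐᵒᵖ (CokerDual d)), hE⟩ ⟨_, _, _, _, _, _, d, hd, rfl⟩
  exact isGP_of_homExactStep x hx (by rw [hx0]; exact LinearEquiv.refl _ _)

end Presentation

end GorensteinProjective

section Finiteness

variable {R : Type u} [Ring R]

lemma IsGP.of_equiv {M N : Type u} [AddCommGroup M] [Module R M] [AddCommGroup N] [Module R N]
    (e : M ≃ₗ[R] N) (h : IsGP R M) : IsGP R N := by
  obtain ⟨P, h₁, h₂, d, h₃, h₄, h₅, h₆, ⟨f⟩⟩ := h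
  exact ⟨P, h₁, h₂, d, h₃, h₄, h₅, h₆, ⟨e.symm.trans f⟩⟩

variable {M N : Type u} [AddCommGroup M] [Module R M] [AddCommGroup N] [Module R N]

lemma IsGP.cokerDual [IsArtinianRing R] [IsArtinianRing Rᵐᵒᵖ] (h : IsGP R M) (pr : MinPres R M) :
    IsGP Rᵐᵒᵖ (CokerDual pr.d) :=
  isGP_cokerDual ⟨pr.fin₁, pr.proj₁, pr.fin₀, pr.proj₀, h.extVanish.of_equiv
    ((Submodule.quotEquivOfEq _ _ pr.exact.linearMap_ker_eq.symm).trans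
      (pr.p.quotKerEquivOfSurjective pr.surj))⟩ (h.extVanish_cokerDual pr)

section Dual

variable [Module.Finite R M] [Module.Projective R M] [Module.Finite R N] [Module.Projective R N]

lemma isGP_dual [IsNoetherianRing R] [IsNoetherianRing Rᵐᵒᵖ] : IsGP Rᵐᵒᵖ (M →ₗ[R] R) := by
  let d : M →ₗ[R] PUnit.{u + 1} := 0
  have hd : LinearMap.range (dualHom d) = ⊥ := by
    rw [eq_bot_iff]
    rintro _ ⟨g, rfl⟩
    exact LinearMap.comp_zero g
  let e : CokerDual d ≃ₗ[Rᵐᵒᵖ] (M →ₗ[R] R) := Submodule.quotEquivOfEqBot _ hd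
  exact (isGP_cokerDual ⟨inferInstance, inferInstance, inferInstance, inferInstance,
    ExtVanish.of_projective.of_retract (Y := PUnit.{u + 1}) 0 0
      (LinearMap.ext fun x => Subsingleton.elim _ _)⟩
    (ExtVanish.of_projective.of_equiv e)).of_equiv e

lemma IsIndec.dual (hM : IsIndec R M) : IsIndec Rᵐᵒᵖ (M →ₗ[R] R) := by
  have : Nontrivial (M →ₗ[R] R) := not_subsingleton_iff_nontrivial.1 fun _ => by
    obtain ⟨x, hx⟩ := @exists_ne M hM.1 0
    refine hx (eq_zero_of_forall_dual (R := R) fun f => ?_)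
    rw [Subsingleton.elim f 0, LinearMap.zero_apply]
  refine IsIndec.of_idempotent fun e he => ?_
  obtain ⟨α, rfl⟩ := dualHom_surjective e
  rcases hM.idempotent α (dualHom_injective he) with rfl | rfl
  · exact Or.inr fun f => ⟨f, by simp [dualHom_apply]⟩
  · exact Or.inl fun f => ⟨f, rfl⟩

lemma nonempty_equiv_of_dual (E : (M →ₗ[R] R) ≃ₗ[Rᵐᵒᵖ] (N →ₗ[R] R)) : Nonempty (M ≃ₗ[R] N) := by
  obtain ⟨α, hα⟩ := dualHom_surjective E.toLinearMap
  obtain ⟨β, hβ⟩ := dualHom_surjective E.symm.toLinearMap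
  refine ⟨LinearEquiv.ofLinearMap β α (dualHom_injective ?_) (dualHom_injective ?_)⟩
  · change (dualHom α).comp (dualHom β) = _
    rw [← hα, ← hβ]
    exact LinearMap.ext fun f => E.apply_symm_apply f
  · change (dualHom β).comp (dualHom α) = _
    rw [← hα, ← hβ]
    exact LinearMap.ext fun f => E.symm_apply_apply f

end Dual

lemma cmTauTiltingFinite_of_classification (K : Type u) [Field K] [Algebra K R] {ι : Type*}
    [Finite ι] (r : ModuleCat.{u} R → ι → Prop)
    (hr : ∀ (M : Type u) [AddCommGroup M] [Module R M], Module.Finite R M →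
      IsIndec R M → IsGP R M → IsTauRigid R K M → ∃ i, r (ModuleCat.of R M) i)
    (hr' : ∀ i (M N : Type u) [AddCommGroup M] [Module R M] [AddCommGroup N] [Module R N],
      Module.Finite R M → Module.Finite R N → IsIndec R M → IsIndec R N →
      r (ModuleCat.of R M) i → r (ModuleCat.of R N) i → Nonempty (M ≃ₗ[R] N)) :
    CMTauTiltingFinite R K := by
  obtain ⟨n, ⟨e⟩⟩ := Finite.exists_equiv_fin ι
  let p : Fin n → ModuleCat.{u} R → Prop := fun j X =>
    Module.Finite R X ∧ IsIndec R X ∧ r X (e.symm j)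
  have hp (j : Fin n) : ∃ Y, (∃ X, p j X) → p j Y := by
    by_cases h : ∃ X, p j X
    · exact ⟨h.choose, fun _ => h.choose_spec⟩
    · exact ⟨ModuleCat.of R PUnit, fun h' => absurd h' h⟩
  choose V hV using hp
  refine ⟨n, V, fun M _ _ h₁ h₂ h₃ h₄ => ?_⟩
  obtain ⟨i, hi⟩ := hr M h₁ h₂ h₃ h₄
  rw [← e.symm_apply_apply i] at hi
  obtain ⟨h₁', h₂', hi'⟩ := hV (e i) ⟨ModuleCat.of R M, h₁, h₂, hi⟩
  exact ⟨e i, hr' _ M _ h₁ h₁' h₂ h₂' hi hi'⟩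

lemma CMTauTiltingFinite.of_op {K : Type u} [Field K] [Algebra K R] [FiniteDimensional K R]
    (h : CMTauTiltingFinite Rᵐᵒᵖ K) : CMTauTiltingFinite R K := by
  have : IsArtinianRing R := IsArtinianRing.of_finite K R
  have : IsArtinianRing Rᵐᵒᵖ := IsArtinianRing.of_finite K Rᵐᵒᵖ
  obtain ⟨n, V, hV⟩ := h
  refine cmTauTiltingFinite_of_classification K (ι := Fin n ⊕ Fin n) (fun M => Sum.elim
    (fun i => Module.Projective R M ∧ Nonempty ((M →ₗ[R] R) ≃ₗ[Rᵐᵒᵖ] V i))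
    (fun i => ¬ Module.Projective R M ∧
      ∃ pr : MinPres R M, Nonempty (CokerDual pr.d ≃ₗ[Rᵐᵒᵖ] V i))) ?_ ?_
  · intro M _ _ _ hM hGP hτ
    by_cases hp : Module.Projective R M
    · obtain ⟨i, hi⟩ := hV (M →ₗ[R] R) inferInstance hM.dual isGP_dual (.of_projective K)
      exact ⟨.inl i, hp, hi⟩
    · obtain ⟨pr⟩ := nonempty_minPres (R := R) M
      obtain ⟨i, hi⟩ := hV (CokerDual pr.d) inferInstance (pr.isIndec_cokerDual hM hp)
        (hGP.cokerDual pr) (hτ.cokerDual K pr)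
      exact ⟨.inr i, hp, pr, hi⟩
  · rintro (i | i) M N _ _ _ _ _ _ hM hN
    · rintro ⟨hp, ⟨e⟩⟩ ⟨hp', ⟨e'⟩⟩
      have : Module.Projective R M := hp
      have : Module.Projective R N := hp'
      exact nonempty_equiv_of_dual (e.trans e'.symm)
    · rintro ⟨hp, pr, ⟨e⟩⟩ ⟨-, qr, ⟨e'⟩⟩
      exact pr.nonempty_equiv_of_cokerDual hM hp qr hN (e.trans e'.symm)

end Finiteness

section RingEquiv

variable {R S : Type u} [Ring R] [Ring S]

/-- The module over `R` obtained from a module over `S` by restriction along `σ : R →+* S`. -/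
def Restriction (_ : R →+* S) (A : Type u) : Type u := A

variable (σ : R →+* S) {σ' : S →+* R} [RingHomInvPair σ σ'] [RingHomInvPair σ' σ]

instance (A : Type u) [h : AddCommGroup A] : AddCommGroup (Restriction σ A) := h

instance (A : Type u) [AddCommGroup A] [Module S A] : Module R (Restriction σ A) :=
  Module.compHom A σ

/-- The identity of `A`, as a semilinear equivalence. -/
def Restriction.equiv (A : Type u) [AddCommGroup A] [Module S A] : Restriction σ A ≃ₛₗ[σ] A where
  toFun x := x
  invFun x := x
  map_add' _ _ := rfl
  map_smul' _ _ := rfl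
  left_inv _ := rfl
  right_inv _ := rfl

variable {σ}

section Hom

variable {A B A₂ B₂ : Type u} [AddCommGroup A] [Module R A] [AddCommGroup B] [Module R B]
  [AddCommGroup A₂] [Module S A₂] [AddCommGroup B₂] [Module S B₂]

/-- Transport of a linear map along semilinear equivalences of the source and target. -/
def conjHom (e : A ≃ₛₗ[σ] A₂) (e' : B ≃ₛₗ[σ] B₂) (f : A₂ →ₗ[S] B₂) : A →ₗ[R] B :=
  e'.symm.toLinearMap.comp (f.comp e.toLinearMap)

variable (e : A ≃ₛₗ[σ] A₂) (e' : B ≃ₛₗ[σ] B₂)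

lemma conjHom_apply (f : A₂ →ₗ[S] B₂) (x : A) : conjHom e e' f x = e'.symm (f (e x)) := rfl

lemma exact_conjHom {C C₂ : Type u} [AddCommGroup C] [Module R C] [AddCommGroup C₂] [Module S C₂]
    (e'' : C ≃ₛₗ[σ] C₂) {f : A₂ →ₗ[S] B₂} {g : B₂ →ₗ[S] C₂} (h : Exact f g) :
    Exact (conjHom e e' f) (conjHom e' e'' g) := by
  intro y
  simp only [conjHom_apply, map_eq_zero_iff _ e''.symm.injective, h (e' y), Set.mem_range]
  exact ⟨fun ⟨x, hx⟩ => ⟨e.symm x, by simp [hx]⟩, fun ⟨x, hx⟩ => ⟨e x, by simp [← hx]⟩⟩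

lemma ker_conjHom (f : A₂ →ₗ[S] B₂) :
    LinearMap.ker (conjHom e e' f) = (LinearMap.ker f).comap e.toLinearMap := by
  ext x
  simp [conjHom_apply]

lemma range_conjHom (f : A₂ →ₗ[S] B₂) :
    LinearMap.range (conjHom e e' f) = (LinearMap.range f).comap e'.toLinearMap := by
  ext x
  simp only [LinearMap.mem_range, conjHom_apply, Submodule.mem_comap]
  exact ⟨fun ⟨y, hy⟩ => ⟨e y, by simp [← hy]⟩, fun ⟨y, hy⟩ => ⟨e.symm y, by
    simpa using congrArg e'.symm hy⟩⟩

lemma IsSuperfluous.comap {N : Submodule S A₂} (h : IsSuperfluous S N) :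
    IsSuperfluous R (N.comap e.toLinearMap) := by
  intro N' hN'
  let φ := (Submodule.orderIsoMapComap e)
  have h1 : N ⊔ φ N' = ⊤ := by
    rw [← φ.map_top, ← hN', φ.map_sup]
    congr 1
    exact (φ.apply_symm_apply N).symm
  rw [← φ.symm_apply_apply N', h _ h1, φ.symm.map_top]

include e in
lemma finite_of_semilinearEquiv [Module.Finite S A₂] : Module.Finite R A :=
  Module.Finite.of_surjective e.symm.toLinearMap e.symm.surjective

end Hom

variable {M N : Type u} [AddCommGroup M] [Module R M] [AddCommGroup N] [Module S N]
  (e : M ≃ₛₗ[σ] N)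

include e

lemma IsIndec.of_semilinearEquiv (h : IsIndec S N) : IsIndec R M := by
  have := h.1
  refine ⟨e.toEquiv.nontrivial, fun N₁ N₂ hc => ?_⟩
  let φ := Submodule.orderIsoMapComap e
  refine (h.2 (φ N₁) (φ N₂) (φ.isCompl hc)).imp (fun h => ?_) (fun h => ?_)
  · exact φ.injective (h.trans φ.map_bot.symm)
  · exact φ.injective (h.trans φ.map_bot.symm)

lemma IsGP.of_semilinearEquiv (h : IsGP S N) : IsGP R M := by
  obtain ⟨P, i₁, i₂, d, hfin, hproj, hex, hdual, ⟨f⟩⟩ := h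
  let ε (n : ℤ) := Restriction.equiv σ (P n)
  let ρ : R ≃ₛₗ[σ] S :=
    { σ.toSemilinearMap with
      invFun := σ'
      left_inv := fun x => RingHomInvPair.comp_apply_eq
      right_inv := fun x => RingHomInvPair.comp_apply_eq₂ }
  refine ⟨fun n => Restriction σ (P n), inferInstance, inferInstance,
    fun n => conjHom (ε n) (ε (n + 1)) (d n), fun n => finite_of_semilinearEquiv (ε n),
    fun n => Module.Projective.of_equiv (ε n).symm, fun n => exact_conjHom _ _ _ (hex n),
    fun n g => ?_, ⟨?_⟩⟩
  · have := hdual n (conjHom (ε _).symm ρ.symm g)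
    constructor
    · intro h0
      obtain ⟨g', hg'⟩ := this.1 (by
        ext x
        have := LinearMap.congr_fun h0 x
        exact (congrArg ρ this).trans (map_zero ρ))
      refine ⟨conjHom (ε _) ρ g', ?_⟩
      ext x
      have := LinearMap.congr_fun hg' x
      exact (congrArg ρ.symm this).trans (ρ.symm_apply_apply _)
    · rintro ⟨g', rfl⟩
      have := this.2 ⟨conjHom (ε _).symm ρ.symm g', by
        ext x
        rfl⟩
      ext x
      have := LinearMap.congr_fun this x
      exact ρ.injective (this.trans (map_zero ρ).symm)
  · let j := conjHom e (ε (-1 + 1)) ((LinearMap.range (d (-1))).subtype.comp f.toLinearMap)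
    have hj : Injective j := (ε (-1 + 1)).symm.injective.comp
      (Subtype.val_injective.comp (f.injective.comp e.injective))
    refine (LinearEquiv.ofInjective j hj).trans (LinearEquiv.ofEq _ _ ?_)
    rw [range_conjHom, range_conjHom, LinearMap.range_comp, LinearEquiv.range, Submodule.map_top,
      Submodule.range_subtype]

lemma IsTauRigid.of_semilinearEquiv (K : Type u) [Field K] [Algebra K R] [Algebra K S]
    (h : IsTauRigid S K N) : IsTauRigid R K M := by
  rw [isTauRigid_iff] at h ⊢
  intro pr φ
  let ε₁ := Restriction.equiv σ' pr.P₁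
  let ε₀ := Restriction.equiv σ' pr.P₀
  let qr : MinPres S N :=
    { P₁ := Restriction σ' pr.P₁
      P₀ := Restriction σ' pr.P₀
      fin₁ := finite_of_semilinearEquiv ε₁
      fin₀ := finite_of_semilinearEquiv ε₀
      proj₁ := Module.Projective.of_equiv ε₁.symm
      proj₀ := Module.Projective.of_equiv ε₀.symm
      d := conjHom ε₁ ε₀ pr.d
      p := conjHom ε₀ e.symm pr.p
      surj := e.surjective.comp (pr.surj.comp ε₀.surjective)
      exact := exact_conjHom _ _ _ pr.exact
      min₀ := by
        rw [ker_conjHom]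
        exact pr.min₀.comap ε₀
      min₁ := by
        rw [ker_conjHom]
        exact pr.min₁.comap ε₁ }
  obtain ⟨g, hg⟩ := h qr (conjHom ε₁ e.symm φ)
  refine ⟨conjHom ε₀.symm e g, LinearMap.ext fun x => ?_⟩
  exact (congrArg e.symm (LinearMap.congr_fun hg x)).trans (e.symm_apply_apply _)

omit e in
lemma CMTauTiltingFinite.of_ringEquiv (φ : R ≃+* S) (K : Type u) [Field K] [Algebra K R]
    [Algebra K S] (h : CMTauTiltingFinite R K) : CMTauTiltingFinite S K := by
  obtain ⟨n, V, hV⟩ := h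
  have := RingHomInvPair.of_ringEquiv φ
  have := RingHomInvPair.symm (φ : R →+* S) (φ.symm : S →+* R)
  let σ : R →+* S := φ
  let σ' : S →+* R := φ.symm
  refine ⟨n, fun i => ModuleCat.of S (Restriction σ' (V i)), fun N _ _ h₁ h₂ h₃ h₄ => ?_⟩
  let e := Restriction.equiv σ N
  obtain ⟨i, ⟨f⟩⟩ := hV (Restriction σ N) (finite_of_semilinearEquiv e) (h₂.of_semilinearEquiv e)
    (h₃.of_semilinearEquiv e) (h₄.of_semilinearEquiv e K)
  exact ⟨i, ⟨e.symm.trans (f.trans (Restriction.equiv σ' (V i)).symm)⟩⟩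

end RingEquiv

/-- An algebra is CM-τ-tilting finite (finitely many
isomorphism classes of indecomposable Gorenstein projective τ-rigid modules)
iff its opposite algebra is. -/
theorem cm_tau_tilting_finite_op (K R : Type u) [Field K] [Ring R]
    [Algebra K R] [FiniteDimensional K R] :
    CMTauTiltingFinite R K ↔ CMTauTiltingFinite Rᵐᵒᵖ K := by
  exact ⟨fun h => CMTauTiltingFinite.of_op (h.of_ringEquiv (RingEquiv.opOp R) K),
    CMTauTiltingFinite.of_op⟩

end GPTau
end

section
/- Let Λ be a finite dimensional algebra over a field K whose Jacobson radical squares to zero (rad(Λ)² = 0). Then Λ is CM-finite, i.e., there are only finitely many isomorphism classes of indecomposable Gorenstein projective modules in mod Λ; in particular Λ is CM-τ-tilting finite. -/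
/-!  Common definitions: Gorenstein projective/injective modules, transpose,
Auslander–Reiten translation, τ-rigid and τ-tilting modules and pairs,
torsion pairs, etc., over a finite dimensional algebra.
Throughout, "mod Λ" is modelled by the category of finitely generated
(left) modules over a finite dimensional `K`-algebra `R`, and
"mod Λᵒᵖ" by finitely generated `Rᵐᵒᵖ`-modules. -/

universe u

open Function MulOpposite

namespace GPTau

section RadSquareZero

open Module

variable {R : Type u} [Ring R]

section Indecomposable

variable {M N : Type u} [AddCommGroup M] [Module R M] [AddCommGroup N] [Module R N]

theorem IsIndec.eq_id_of_isIdempotentElem (hM : IsIndec R M) {g : M →ₗ[R] M}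
    (hg : IsIdempotentElem g) (h0 : g ≠ 0) : g = LinearMap.id := by
  rcases hM.2 _ _ (LinearMap.IsIdempotentElem.isCompl hg) with h | h
  · exact absurd (LinearMap.range_eq_bot.mp h) h0
  · ext m
    exact LinearMap.ker_eq_bot.mp h (LinearMap.congr_fun hg m)

/-- A split monomorphism from a nonzero module to an indecomposable one is bijective. -/
theorem IsIndec.bijective_of_comp_eq_id [Nontrivial N] (hM : IsIndec R M)
    {i : N →ₗ[R] M} {r : M →ₗ[R] N} (h : r ∘ₗ i = LinearMap.id) : Bijective i := by
  have hri (x : N) : r (i x) = x := LinearMap.congr_fun h x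
  have hid : i ∘ₗ r = LinearMap.id := by
    refine hM.eq_id_of_isIdempotentElem (LinearMap.ext fun m => ?_) fun h0 => ?_
    · simp [hri]
    · obtain ⟨x, hx⟩ := exists_ne (0 : N)
      apply hx
      simpa [hri] using congrArg r (LinearMap.congr_fun h0 (i x))
  exact ⟨LeftInverse.injective hri, RightInverse.surjective (LinearMap.congr_fun hid)⟩

theorem IsIndec.isSimpleModule [IsSemisimpleModule R M] (hM : IsIndec R M) :
    IsSimpleModule R M := by
  have := hM.1
  rw [isSimpleModule_iff]
  refine ⟨fun N₁ => ?_⟩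
  obtain ⟨N₂, h⟩ := exists_isCompl N₁
  rcases hM.2 N₁ N₂ h with h1 | h2
  · exact .inl h1
  · subst h2
    exact .inr (eq_top_of_isCompl_bot h)

end Indecomposable

section Artinian

variable [IsArtinianRing R]

theorem isSemisimpleModule_of_isTorsionBySet_jacobson {M : Type u} [AddCommGroup M] [Module R M]
    (hM : IsTorsionBySet R M (Ring.jacobson R)) : IsSemisimpleModule R M := by
  let := hM.module
  exact hM.isSemisimpleModule_iff.mp inferInstance

instance : IsSemisimpleModule R (R ⧸ Ring.jacobson R) :=
  isSemisimpleModule_of_isTorsionBySet_jacobson fun m r => by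
    obtain ⟨x, rfl⟩ := Ideal.Quotient.mk_surjective m
    exact Ideal.Quotient.eq_zero_iff_mem.mpr (Ideal.mul_mem_right x _ r.2)

variable (R) in
/-- Over an Artinian ring there are only finitely many simple modules. -/
theorem exists_fin_forall_isSimpleModule_equiv :
    ∃ (n : ℕ) (S : Fin n → ModuleCat.{u} R),
      ∀ (M : Type u) [AddCommGroup M] [Module R M], IsSimpleModule R M →
        ∃ i, Nonempty (M ≃ₗ[R] S i) := by
  obtain ⟨n, S, e, hS⟩ :=
    IsSemisimpleModule.exists_linearEquiv_fin_dfinsupp R (R ⧸ Ring.jacobson R)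
  refine ⟨n, fun i => ModuleCat.of R (S i), fun M _ _ hM => ?_⟩
  have := IsSimpleModule.nontrivial R M
  obtain ⟨m, hm⟩ := exists_ne (0 : M)
  let q : (R ⧸ Ring.jacobson R) →ₗ[R] M :=
    Submodule.liftQ _ (LinearMap.toSpanSingleton R M m) fun r hr =>
      mem_annihilator.mp (IsSemisimpleModule.jacobson_le_annihilator R M hr) m
  have hq : q ∘ₗ e.symm.toLinearMap ≠ 0 := fun h0 => hm <| by
    have h1 : q (e.symm (e (Submodule.Quotient.mk 1))) = 0 := LinearMap.congr_fun h0 _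
    rw [e.symm_apply_apply] at h1
    exact (one_smul R m).symm.trans h1
  obtain ⟨i, hi⟩ : ∃ i, (q ∘ₗ e.symm.toLinearMap) ∘ₗ DFinsupp.lsingle i ≠ 0 := by
    by_contra! h
    exact hq (DFinsupp.lhom_ext' fun i => by rw [h i, LinearMap.zero_comp])
  have := hS i
  exact ⟨i, ⟨(LinearEquiv.ofBijective _ (LinearMap.bijective_of_ne_zero hi)).symm⟩⟩

/-- A left ideal not contained in the radical (of square zero) contains a nonzero idempotent. -/
theorem exists_isIdempotentElem_mem (hR : ∀ x ∈ Ring.jacobson R, x * x = 0)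
    {L : Ideal R} (hL : ¬ L ≤ Ring.jacobson R) :
    ∃ e ∈ L, IsIdempotentElem e ∧ e ≠ 0 := by
  obtain ⟨a, ha, hspan⟩ := IsSemisimpleRing.ideal_eq_span_idempotent
    (L.map (Ideal.Quotient.mk (Ring.jacobson R)))
  have haL : a ∈ L.map (Ideal.Quotient.mk (Ring.jacobson R)) :=
    hspan ▸ Ideal.mem_span_singleton_self a
  obtain ⟨x, hxL, rfl⟩ :=
    (Ideal.mem_map_iff_of_surjective _ Ideal.Quotient.mk_surjective).mp haL
  have hxJ : x * x - x ∈ Ring.jacobson R := by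
    rw [← Ideal.Quotient.eq, map_mul]
    exact ha
  have hx : x ∉ Ring.jacobson R := fun hx => hL fun y hy => by
    have hy' := Ideal.mem_map_of_mem (Ideal.Quotient.mk (Ring.jacobson R)) hy
    rw [hspan, Ideal.Quotient.eq_zero_iff_mem.mpr hx, Ideal.span_singleton_zero] at hy'
    exact Ideal.Quotient.eq_zero_iff_mem.mp hy'
  refine ⟨(3 - 2 * x) * x * x, L.mul_mem_left _ hxL, ?_, fun h0 => hx ?_⟩
  · rw [IsIdempotentElem, ← sub_eq_zero]
    have h := congrArg ((4 * x * x - 4 * x - 3) * ·) (hR _ hxJ)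
    simp only [mul_zero] at h
    rw [← h]
    noncomm_ring
  · have h1 : x = (3 - 2 * x) * x * x - (1 - 2 * x) * (x * x - x) := by noncomm_ring
    rw [h1, h0, zero_sub]
    exact neg_mem (Ideal.mul_mem_left _ _ hxJ)

/-- Over an Artinian ring with radical square zero, a linear form on an indecomposable module with
image not contained in the radical is a split monomorphism. -/
theorem IsIndec.exists_comp_eq_id (hR : ∀ x ∈ Ring.jacobson R, x * x = 0)
    {M : Type u} [AddCommGroup M] [Module R M] (hM : IsIndec R M) {f : M →ₗ[R] R}
    (hf : ¬ LinearMap.range f ≤ Ring.jacobson R) :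
    ∃ s : R →ₗ[R] M, s ∘ₗ f = LinearMap.id := by
  obtain ⟨_, ⟨m, rfl⟩, he, h0⟩ := exists_isIdempotentElem_mem hR hf
  have he' : f m * f m = f m := he
  refine ⟨LinearMap.toSpanSingleton R M (f m • m),
    hM.eq_id_of_isIdempotentElem (LinearMap.ext fun x => ?_) fun hz => h0 ?_⟩
  · simp [smul_smul, mul_assoc, he']
  · simpa [he'] using congrArg f (LinearMap.congr_fun hz m)

/-- Two indecomposable modules having linear forms whose composites with maps to a common simple
module are nonzero are isomorphic. -/
theorem IsIndec.nonempty_linearEquiv_of_simple (hR : ∀ x ∈ Ring.jacobson R, x * x = 0)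
    {M N S : Type u} [AddCommGroup M] [Module R M] [AddCommGroup N] [Module R N]
    [AddCommGroup S] [Module R S] [IsSimpleModule R S]
    (hM : IsIndec R M) (hN : IsIndec R N) {f : M →ₗ[R] R} {g : N →ₗ[R] R}
    {p q : R →ₗ[R] S} (hp : p ∘ₗ f ≠ 0) (hq : q ∘ₗ g ≠ 0) :
    Nonempty (M ≃ₗ[R] N) := by
  have hker (r : R →ₗ[R] S) : Ring.jacobson R ≤ LinearMap.ker r :=
    IsSemisimpleModule.jacobson_le_ker (f := r)
  have hrange {X : Type u} [AddCommGroup X] [Module R X] {r : R →ₗ[R] S} {h : X →ₗ[R] R}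
      (hne : r ∘ₗ h ≠ 0) : ¬ LinearMap.range h ≤ Ring.jacobson R := fun hle =>
    hne (LinearMap.range_le_ker_iff.mp (hle.trans (hker r)))
  obtain ⟨t, ht⟩ := hN.exists_comp_eq_id hR (hrange hq)
  have : Projective R N := Projective.of_split g t ht
  obtain ⟨φ, hφ⟩ := projective_lifting_property (p ∘ₗ f) (q ∘ₗ g)
    (LinearMap.surjective_of_ne_zero hp)
  have hφ' : p ∘ₗ (f ∘ₗ φ) ≠ 0 := by rwa [← LinearMap.comp_assoc, hφ]
  obtain ⟨s, hs⟩ := hN.exists_comp_eq_id hR (hrange hφ')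
  have := hN.1
  exact ⟨(LinearEquiv.ofBijective φ
    (hM.bijective_of_comp_eq_id (r := s ∘ₗ f) (by rw [LinearMap.comp_assoc, hs]))).symm⟩

end Artinian

theorem IsGP.exists_injective_finsupp {M : Type u} [AddCommGroup M] [Module R M]
    (hM : IsGP R M) : ∃ (ι : Type u) (f : M →ₗ[R] ι →₀ R), Injective f := by
  obtain ⟨P, _, _, d, -, hproj, -, -, ⟨e⟩⟩ := hM
  obtain ⟨s, hs⟩ := projective_def.mp (hproj (-1 + 1))
  exact ⟨_, s ∘ₗ Submodule.subtype _ ∘ₗ e.toLinearMap,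
    hs.injective.comp (Subtype.val_injective.comp e.injective)⟩

theorem RadSquareZero.mul_eq_zero (hR : RadSquareZero R) {x y : R} (hx : x ∈ Ring.jacobson R)
    (hy : y ∈ Ring.jacobson R) : x * y = 0 := by
  rw [← Ideal.jacobson_bot] at hx hy
  exact hR x y hx hy

/-- An indecomposable submodule of a free module over an Artinian ring with radical square zero is
simple or admits a linear form that is nonzero modulo a maximal left ideal. -/
theorem RadSquareZero.isSimpleModule_or [IsArtinianRing R] (hR : RadSquareZero R)
    {M : Type u} [AddCommGroup M] [Module R M] (hM : IsIndec R M)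
    {ι : Type u} {i : M →ₗ[R] ι →₀ R} (hi : Injective i) :
    IsSimpleModule R M ∨ ∃ (f : M →ₗ[R] R) (m : Ideal R), m.IsMaximal ∧ m.mkQ ∘ₗ f ≠ 0 := by
  by_cases h : ∀ f : M →ₗ[R] R, LinearMap.range f ≤ Ring.jacobson R
  · have : IsSemisimpleModule R M := isSemisimpleModule_of_isTorsionBySet_jacobson fun x r => by
      apply hi
      ext k
      have hk := h (Finsupp.lapply k ∘ₗ i) ⟨x, rfl⟩
      simpa using hR.mul_eq_zero r.2 hk
    exact .inl hM.isSimpleModule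
  · push Not at h
    obtain ⟨f, hf⟩ := h
    obtain ⟨_, ⟨x, rfl⟩, hx⟩ := SetLike.not_le_iff_exists.mp hf
    rw [Ring.jacobson_eq_sInf_isMaximal, Ideal.mem_sInf] at hx
    push Not at hx
    obtain ⟨m, hm, hxm⟩ := hx
    exact .inr ⟨f, m, hm, fun h0 =>
      hxm ((Submodule.Quotient.mk_eq_zero m).mp (LinearMap.congr_fun h0 x))⟩

theorem RadSquareZero.cmFinite [IsArtinianRing R] (hR : RadSquareZero R) : CMFinite R := by
  classical
  obtain ⟨n, S, hS⟩ := exists_fin_forall_isSimpleModule_equiv R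
  let T (i : Fin n) (M : ModuleCat.{u} R) : Prop :=
    IsSimpleModule R (S i) ∧ IsIndec R M ∧ ∃ (f : M →ₗ[R] R) (p : R →ₗ[R] S i), p ∘ₗ f ≠ 0
  let V : Fin n ⊕ Fin n → ModuleCat.{u} R :=
    Sum.elim S fun i => if h : ∃ M, T i M then h.choose else S i
  refine ⟨n + n, V ∘ finSumFinEquiv.symm, fun M _ _ _ hind hgp => ?_⟩
  suffices h : ∃ j, Nonempty (M ≃ₗ[R] V j) by
    obtain ⟨j, hj⟩ := h
    exact ⟨finSumFinEquiv j, by rwa [comp_apply, Equiv.symm_apply_apply]⟩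
  obtain ⟨_, i, hi⟩ := hgp.exists_injective_finsupp
  rcases hR.isSimpleModule_or hind hi with hs | ⟨f, m, hm, hf⟩
  · obtain ⟨j, hj⟩ := hS M hs
    exact ⟨.inl j, hj⟩
  · have hsimple : IsSimpleModule R (R ⧸ m) := isSimpleModule_iff_isCoatom.mpr hm.out
    obtain ⟨j, ⟨e⟩⟩ := hS (R ⧸ m) hsimple
    have hSj : IsSimpleModule R (S j) := IsSimpleModule.congr e.symm
    have hef : (e.toLinearMap ∘ₗ m.mkQ) ∘ₗ f ≠ 0 := fun h0 => hf <| by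
      ext x
      exact e.injective ((LinearMap.congr_fun h0 x).trans e.map_zero.symm)
    have hT : ∃ M, T j M := ⟨ModuleCat.of R M, hSj, hind, f, _, hef⟩
    obtain ⟨-, hN, g, q, hq⟩ := hT.choose_spec
    refine ⟨.inr j, ?_⟩
    have hV : V (.inr j) = hT.choose := dif_pos hT
    rw [hV]
    exact hind.nonempty_linearEquiv_of_simple (fun x hx => hR.mul_eq_zero hx hx) hN hef hq

end RadSquareZero

/-- An algebra with radical square zero is CM-finite, and in
particular CM-τ-tilting finite. -/
theorem rad_square_zero_cm_finite (K R : Type u) [Field K] [Ring R]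
    [Algebra K R] [FiniteDimensional K R]
    (h : RadSquareZero R) :
    CMFinite R ∧ CMTauTiltingFinite R K := by
  have := IsArtinianRing.of_finite K R
  obtain ⟨n, V, hV⟩ := h.cmFinite
  exact ⟨⟨n, V, hV⟩, n, V, fun M _ _ hfin hind hgp _ => hV M hfin hind hgp⟩

end GPTau
end
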